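/- Let l ≥ 2, let ε_k → 0 with ε_k > 0, and let u_k : B_1 → ℝ^l be smooth sphere-valued ε_k-harmonic maps with uniformly bounded ε-energy: sup_k ∫_{B_1} (|∇u_k|² + ε_k |Δu_k|²) dx < ∞. Let r_k → 0 with r_k > 0 and let ω : ℝ² → ℝ^l be a smooth nonconstant map with 0 < ∫_{ℝ²} |Δω|² dx < ∞ such that the rescalings v_k(y) = u_k(r_k y) converge to ω in C³ on every compact subset of ℝ². Assume the single-bubble neck condition: for every δ > 0 there exist R ≥ 1, R₀ ∈ (0,1) and K such that for all k ≥ K, (a) |∇^t u_k(x)| ≤ √δ |x|^{−t} for t ∈ {1,2,3} and all x with 2Rr_k ≤ |x| ≤ R₀/4, and (b) ∫_{A(a,2a)} (|∇u_k|² + ε_k |Δu_k|²) dx ≤ δ for every a with Rr_k < a < R₀/2. Then limsup_{k→∞} (ε_k / r_k²) log(1/r_k) < ∞. -/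

import Mathlib

open scoped RealInnerProductSpace
open Filter MeasureTheory Metric

noncomputable section

/-- The plane `ℝ²` as a Euclidean space. -/
abbrev E2 : Type := EuclideanSpace ℝ (Fin 2)

/-- Euclidean space `ℝ^l`. -/
abbrev Eu (l : ℕ) : Type := EuclideanSpace ℝ (Fin l)

/-- Partial derivative `∂_α u` of a map `u : ℝ² → ℝ^l`. -/
def pd {l : ℕ} (α : Fin 2) (u : E2 → Eu l) (x : E2) : Eu l :=
  fderiv ℝ u x (EuclideanSpace.single α 1)

/-- Partial derivative `∂_α f` of a scalar function `f : ℝ² → ℝ`. -/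
def pds (α : Fin 2) (f : E2 → ℝ) (x : E2) : ℝ :=
  fderiv ℝ f x (EuclideanSpace.single α 1)

/-- The componentwise Laplacian `Δu = ∂₁∂₁u + ∂₂∂₂u`. -/
def lap {l : ℕ} (u : E2 → Eu l) (x : E2) : Eu l :=
  pd 0 (pd 0 u) x + pd 1 (pd 1 u) x

/-- `|∇u|² = |∂₁u|² + |∂₂u|²`. -/
def gradSq {l : ℕ} (u : E2 → Eu l) (x : E2) : ℝ :=
  ‖pd 0 u x‖ ^ 2 + ‖pd 1 u x‖ ^ 2

/-- The harmonic stress-energy tensor `S¹_{αβ}(u) = ½|∇u|²δ_{αβ} − ⟨∂_α u, ∂_β u⟩`. -/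
def S1 {l : ℕ} (u : E2 → Eu l) (α β : Fin 2) (x : E2) : ℝ :=
  (1 / 2) * gradSq u x * (if α = β then 1 else 0) - ⟪pd α u x, pd β u x⟫

/-- Jiang's biharmonic stress-energy tensor
`S²_{αβ}(u) = ½|Δu|²δ_{αβ} + ∑_γ ⟨∂_γ u, ∂_γ Δu⟩ δ_{αβ} − ⟨∂_α u, ∂_β Δu⟩ − ⟨∂_β u, ∂_α Δu⟩`. -/
def S2 {l : ℕ} (u : E2 → Eu l) (α β : Fin 2) (x : E2) : ℝ :=
  (1 / 2) * ‖lap u x‖ ^ 2 * (if α = β then 1 else 0)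
    + (∑ γ : Fin 2, ⟪pd γ u x, pd γ (lap u) x⟫) * (if α = β then 1 else 0)
    - ⟪pd α u x, pd β (lap u) x⟫ - ⟪pd β u x, pd α (lap u) x⟫

/-- A sphere-valued map `u : Ω → S^{l-1} ⊂ ℝ^l` is `ε`-harmonic if `Δu − εΔ²u` is a real
scalar multiple of `u` at every point of `Ω` (the Euler–Lagrange equation of the ε-energy). -/
def IsEpsHarmonic {l : ℕ} (ε : ℝ) (Ω : Set E2) (u : E2 → Eu l) : Prop :=
  ∀ x ∈ Ω, ∃ c : ℝ, lap u x - ε • lap (lap u) x = c • u x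

/-- The point `(a, b) ∈ ℝ²`. -/
def pt (a b : ℝ) : E2 := (WithLp.equiv 2 (Fin 2 → ℝ)).symm ![a, b]

/-- The radial derivative `∂_r u(x) = Du(x)[x/|x|]`. -/
def radialDeriv {l : ℕ} (u : E2 → Eu l) (x : E2) : Eu l :=
  fderiv ℝ u x (‖x‖⁻¹ • x)

/-- The angular derivative `∂_θ u(x) = Du(x)[(-x₂, x₁)]`, so that
`|∇u|² = |∂_r u|² + |x|⁻²|∂_θ u|²`. -/
def angularDeriv {l : ℕ} (u : E2 → Eu l) (x : E2) : Eu l :=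
  fderiv ℝ u x (pt (-(x 1)) (x 0))

/-- The circle integral `∫_{∂B_t} f dS = ∫₀^{2π} f(t cos θ, t sin θ) t dθ`. -/
def circInt (t : ℝ) (f : E2 → ℝ) : ℝ :=
  ∫ θ in (0:ℝ)..(2 * Real.pi), f (pt (t * Real.cos θ) (t * Real.sin θ)) * t

/-- The open annulus `A(p,q) = {x ∈ ℝ² : p < |x| < q}`. -/
def ann (p q : ℝ) : Set E2 := {x : E2 | p < ‖x‖ ∧ ‖x‖ < q}

/-- The `ε`-energy density `|∇u|² + ε|Δu|²`. -/
def eDen {l : ℕ} (ε : ℝ) (u : E2 → Eu l) (x : E2) : ℝ :=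
  gradSq u x + ε * ‖lap u x‖ ^ 2

/-- The algebra of smooth real functions on the plane. -/
def smoothAlg : Subalgebra ℝ (E2 → ℝ) where
  carrier := {f | ContDiff ℝ (⊤ : ℕ∞) f}
  mul_mem' := fun {f g} (hf : ContDiff ℝ (⊤ : ℕ∞) f) (hg : ContDiff ℝ (⊤ : ℕ∞) g) => hf.mul hg
  add_mem' := fun {f g} (hf : ContDiff ℝ (⊤ : ℕ∞) f) (hg : ContDiff ℝ (⊤ : ℕ∞) g) => hf.add hg
  algebraMap_mem' := fun c => (contDiff_const : ContDiff ℝ (⊤ : ℕ∞) (fun _ : E2 => c))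

/-- Smooth real functions on the plane. -/
abbrev Sm : Type := smoothAlg

namespace Sm

lemma contDiff (f : Sm) : ContDiff ℝ (⊤ : ℕ∞) f.1 := f.2

lemma continuous (f : Sm) : Continuous f.1 := f.contDiff.continuous

lemma differentiable (f : Sm) : Differentiable ℝ f.1 := f.contDiff.differentiable (by simp)

@[simp] lemma val_add (f g : Sm) (x : E2) : (f + g).1 x = f.1 x + g.1 x := rfl
@[simp] lemma val_sub (f g : Sm) (x : E2) : (f - g).1 x = f.1 x - g.1 x := rfl
@[simp] lemma val_neg (f : Sm) (x : E2) : (-f).1 x = -f.1 x := rfl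
@[simp] lemma val_mul (f g : Sm) (x : E2) : (f * g).1 x = f.1 x * g.1 x := rfl
@[simp] lemma val_smul (c : ℝ) (g : Sm) (x : E2) : (c • g).1 x = c * g.1 x := rfl
@[simp] lemma val_zero (x : E2) : (0 : Sm).1 x = 0 := rfl
@[simp] lemma val_one (x : E2) : (1 : Sm).1 x = 1 := rfl
@[simp] lemma val_pow (f : Sm) (n : ℕ) (x : E2) : (f ^ n).1 x = f.1 x ^ n := rfl

@[simp] lemma val_sum {ι : Type*} (s : Finset ι) (f : ι → Sm) (x : E2) :
    (∑ i ∈ s, f i).1 x = ∑ i ∈ s, (f i).1 x := by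
  induction s using Finset.cons_induction with
  | empty => simp
  | cons a s ha ih => simp [Finset.sum_cons, ih]

lemma contDiff_pds (α : Fin 2) (f : Sm) : ContDiff ℝ (⊤ : ℕ∞) (pds α f.1) := by
  unfold pds
  exact (f.contDiff.fderiv_right (m := (⊤ : ℕ∞)) (by simp)).clm_apply contDiff_const

/-- The partial derivative as a derivation of smooth functions. -/
def D (α : Fin 2) : Derivation ℝ Sm Sm :=
  Derivation.mk'
    { toFun := fun f => ⟨pds α f.1, contDiff_pds α f⟩
      map_add' := fun f g => by
        ext x
        change fderiv ℝ (f.1 + g.1) x _ = fderiv ℝ f.1 x _ + fderiv ℝ g.1 x _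
        rw [fderiv_add f.differentiable.differentiableAt g.differentiable.differentiableAt]
        rfl
      map_smul' := fun c f => by
        ext x
        change fderiv ℝ (c • f.1) x _ = c • fderiv ℝ f.1 x _
        rw [fderiv_const_smul f.differentiable.differentiableAt]
        rfl }
    (fun f g => by
      ext x
      change fderiv ℝ (f.1 * g.1) x _ = f.1 x * fderiv ℝ g.1 x _ + g.1 x * fderiv ℝ f.1 x _
      rw [fderiv_mul f.differentiable.differentiableAt g.differentiable.differentiableAt]
      rfl)

lemma D_val (α : Fin 2) (f : Sm) (x : E2) : (D α f).1 x = pds α f.1 x := rfl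

/-- The coordinate functions. -/
def X (α : Fin 2) : Sm := ⟨fun x => x α, show ContDiff ℝ (⊤ : ℕ∞) (fun x : E2 => x α) by fun_prop⟩

@[simp] lemma X_val (α : Fin 2) (x : E2) : (X α).1 x = x α := rfl

lemma D_X (α β : Fin 2) : D α (X β) = if α = β then 1 else 0 := by
  ext x
  rw [D_val]
  unfold pds
  have h : (X β).1 = (EuclideanSpace.proj β : E2 →L[ℝ] ℝ) := by
    ext y; simp
  rw [h, ContinuousLinearMap.fderiv]
  by_cases hab : α = β
  · simp [hab]
  · simp [hab, Ne.symm hab]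

@[simp] lemma D_X00 : D 0 (X 0) = 1 := by simp [D_X]
@[simp] lemma D_X11 : D 1 (X 1) = 1 := by simp [D_X]
@[simp] lemma D_X01 : D 0 (X 1) = 0 := by simp [D_X]
@[simp] lemma D_X10 : D 1 (X 0) = 0 := by simp [D_X]

@[simp] lemma D_mul (α : Fin 2) (f g : Sm) : D α (f * g) = f * D α g + g * D α f := by
  simp [Derivation.leibniz]

lemma D_comm (α β : Fin 2) (f : Sm) : D α (D β f) = D β (D α f) := by
  ext x
  have key : ∀ γ δ : Fin 2, (D γ (D δ f)).1 x =
      fderiv ℝ (fderiv ℝ f.1) x (EuclideanSpace.single γ 1) (EuclideanSpace.single δ 1) := by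
    intro γ δ
    change fderiv ℝ (fun y => fderiv ℝ f.1 y (EuclideanSpace.single δ 1)) x
      (EuclideanSpace.single γ 1) = _
    have h1 : DifferentiableAt ℝ (fderiv ℝ f.1) x :=
      ((f.contDiff.fderiv_right (m := (⊤ : ℕ∞)) (by simp)).differentiable
        (by simp)).differentiableAt
    rw [fderiv_clm_apply h1 (differentiableAt_const _)]
    simp
  rw [key, key]
  have hs : IsSymmSndFDerivAt ℝ f.1 x :=
    (contDiff_infty.1 f.contDiff 2).contDiffAt.isSymmSndFDerivAt (by simp)
  exact hs.eq _ _

@[simp] lemma D_one_zero (f : Sm) : D 1 (D 0 f) = D 0 (D 1 f) := D_comm 1 0 f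

/-- The Laplacian of a smooth function. -/
def L (f : Sm) : Sm := D 0 (D 0 f) + D 1 (D 1 f)

/-- The angular derivative. -/
def Th (f : Sm) : Sm := X 0 * D 1 f - X 1 * D 0 f

/-- The Euler derivative `x · ∇`. -/
def euler (f : Sm) : Sm := X 0 * D 0 f + X 1 * D 1 f

/-- Divergence of the stress-energy field contracted with the Euler field. -/
lemma div_stress (f : Sm) (c : ℝ) :
    D 0 ((1 / 2 : ℝ) • (X 0 * (D 0 f * D 0 f + D 1 f * D 1 f)) - euler f * D 0 f
        - c • ((1 / 2 : ℝ) • (X 0 * (L f * L f)) + X 0 * (D 0 f * D 0 (L f) + D 1 f * D 1 (L f))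
          - euler f * D 0 (L f) - D 0 f * euler (L f)))
      + D 1 ((1 / 2 : ℝ) • (X 1 * (D 0 f * D 0 f + D 1 f * D 1 f)) - euler f * D 1 f
        - c • ((1 / 2 : ℝ) • (X 1 * (L f * L f)) + X 1 * (D 0 f * D 0 (L f) + D 1 f * D 1 (L f))
          - euler f * D 1 (L f) - D 1 f * euler (L f)))
      = -(euler f * (L f - c • L (L f))) - c • (L f * L f) := by
  ext x
  simp [euler, L]
  ring

lemma div_angular (f : Sm) :
    D 0 (-(X 1 * (L f * Th f)) - Th f * D 0 (Th f)) + D 1 (X 0 * (L f * Th f) - Th f * D 1 (Th f))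
      = L f * Th (Th f) - (D 0 (Th f) * D 0 (Th f) + D 1 (Th f) * D 1 (Th f)) := by
  ext x
  simp [Th, L]
  ring

lemma div_green (g w : Sm) :
    D 0 (g * D 0 w) + D 1 (g * D 1 w) = g * L w + (D 0 g * D 0 w + D 1 g * D 1 w) := by
  ext x
  simp [L]
  ring

lemma div_current (f g : Sm) (c : ℝ) :
    D 0 (f * D 0 g - g * D 0 f
        - c • (f * D 0 (L g) - g * D 0 (L f) - D 0 f * L g + D 0 g * L f))
      + D 1 (f * D 1 g - g * D 1 f
        - c • (f * D 1 (L g) - g * D 1 (L f) - D 1 f * L g + D 1 g * L f))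
      = f * (L g - c • L (L g)) - g * (L f - c • L (L f)) := by
  ext x
  simp [L]
  ring

lemma Th_Eu_comm (f : Sm) : Th (euler f) = euler (Th f) := by
  ext x
  simp [Th, euler]
  ring

lemma Th_mul (f g : Sm) : Th (f * g) = f * Th g + g * Th f := by
  ext x; simp [Th]; ring

lemma Th_sub (f g : Sm) : Th (f - g) = Th f - Th g := by
  ext x; simp [Th]; ring

end Sm

/-- A weak Poincaré inequality on the circle. -/
lemma circle_poincare (F F' : ℝ → ℝ) (hF : ∀ θ, HasDerivAt F (F' θ) θ) (hF' : Continuous F') :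
    (∫ θ in (-Real.pi)..Real.pi, F θ ^ 2)
      - ((2 * Real.pi)⁻¹ * ∫ θ in (-Real.pi)..Real.pi, F θ) * (∫ θ in (-Real.pi)..Real.pi, F θ)
      ≤ 2 * Real.pi ^ 2 * ∫ θ in (-Real.pi)..Real.pi, F' θ ^ 2 := by
  have hpi := Real.pi_pos
  have hFc : Continuous F := continuous_iff_continuousAt.2 fun θ => (hF θ).continuousAt
  set I := ∫ θ in (-Real.pi)..Real.pi, |F' θ| with hI
  set Q := ∫ θ in (-Real.pi)..Real.pi, F' θ ^ 2 with hQ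
  set A := ∫ θ in (-Real.pi)..Real.pi, F θ with hA
  set B := ∫ θ in (-Real.pi)..Real.pi, F θ ^ 2 with hB
  have hCS : I ^ 2 ≤ 2 * Real.pi * Q := by
    have h0 : 0 ≤ ∫ θ in (-Real.pi)..Real.pi, (2 * Real.pi * |F' θ| - I) ^ 2 :=
      intervalIntegral.integral_nonneg (by linarith) fun _ _ => sq_nonneg _
    have h1 : (∫ θ in (-Real.pi)..Real.pi, (2 * Real.pi * |F' θ| - I) ^ 2)
        = 4 * Real.pi ^ 2 * Q - 4 * Real.pi * I * I + I ^ 2 * (2 * Real.pi) := by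
      have : ∀ θ, (2 * Real.pi * |F' θ| - I) ^ 2
          = 4 * Real.pi ^ 2 * F' θ ^ 2 - 4 * Real.pi * I * |F' θ| + I ^ 2 := by
        intro θ
        have := sq_abs (F' θ)
        linear_combination (4 * Real.pi ^ 2) * this
      simp_rw [this]
      rw [intervalIntegral.integral_add, intervalIntegral.integral_sub,
        intervalIntegral.integral_const_mul, intervalIntegral.integral_const_mul,
        intervalIntegral.integral_const, smul_eq_mul]
      · ring
      all_goals exact Continuous.intervalIntegrable (by fun_prop) _ _
    rw [h1] at h0
    have : 0 ≤ 2 * Real.pi * (2 * Real.pi * Q - I ^ 2) := by nlinarith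
    have := nonneg_of_mul_nonneg_right this (by positivity)
    linarith
  have hdiff : ∀ θ ∈ Set.Icc (-Real.pi) Real.pi, ∀ φ ∈ Set.Icc (-Real.pi) Real.pi,
      φ ≤ θ → (F θ - F φ) ^ 2 ≤ 2 * Real.pi * Q := by
    intro θ hθ φ hφ hle
    have h1 : F θ - F φ = ∫ s in φ..θ, F' s :=
      (intervalIntegral.integral_eq_sub_of_hasDerivAt (fun x _ => hF x)
        (hF'.intervalIntegrable _ _)).symm
    have h2 : |F θ - F φ| ≤ I := by
      rw [h1]
      refine (intervalIntegral.abs_integral_le_integral_abs hle).trans ?_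
      exact intervalIntegral.integral_mono_interval hφ.1 hle hθ.2
        (Eventually.of_forall fun _ => abs_nonneg _) (hF'.abs.intervalIntegrable _ _)
    calc (F θ - F φ) ^ 2 = |F θ - F φ| ^ 2 := (sq_abs _).symm
      _ ≤ I ^ 2 := by gcongr
      _ ≤ _ := hCS
  have hdiff' : ∀ θ ∈ Set.Icc (-Real.pi) Real.pi, ∀ φ ∈ Set.Icc (-Real.pi) Real.pi,
      (F θ - F φ) ^ 2 ≤ 2 * Real.pi * Q := by
    intro θ hθ φ hφ
    rcases le_total φ θ with h | h
    · exact hdiff θ hθ φ hφ h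
    · have := hdiff φ hφ θ hθ h
      linarith [sub_sq_comm (F θ) (F φ)]
  have hin : ∀ θ ∈ Set.Icc (-Real.pi) Real.pi,
      2 * Real.pi * F θ ^ 2 - 2 * A * F θ + B ≤ 2 * Real.pi * (2 * Real.pi * Q) := by
    intro θ hθ
    have h1 : (∫ φ in (-Real.pi)..Real.pi, (F θ - F φ) ^ 2)
        = 2 * Real.pi * F θ ^ 2 - 2 * A * F θ + B := by
      have : ∀ φ, (F θ - F φ) ^ 2 = F θ ^ 2 - 2 * F θ * F φ + F φ ^ 2 := fun φ => by ring
      simp_rw [this]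
      rw [intervalIntegral.integral_add, intervalIntegral.integral_sub,
        intervalIntegral.integral_const_mul,
        intervalIntegral.integral_const, smul_eq_mul]
      · ring
      all_goals exact Continuous.intervalIntegrable (by fun_prop) _ _
    rw [← h1]
    have := intervalIntegral.integral_mono_on (μ := volume) (a := -Real.pi) (b := Real.pi)
      (by linarith) (f := fun φ => (F θ - F φ) ^ 2) (g := fun _ => 2 * Real.pi * Q)
      (Continuous.intervalIntegrable (by fun_prop) _ _)
      (Continuous.intervalIntegrable (by fun_prop) _ _) (fun φ hφ => hdiff' θ hθ φ hφ)
    rw [intervalIntegral.integral_const, smul_eq_mul] at this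
    linarith
  have hout := intervalIntegral.integral_mono_on (μ := volume) (a := -Real.pi) (b := Real.pi)
      (by linarith) (f := fun θ => 2 * Real.pi * F θ ^ 2 - 2 * A * F θ + B)
      (g := fun _ => 2 * Real.pi * (2 * Real.pi * Q))
      (Continuous.intervalIntegrable (by fun_prop) _ _)
      (Continuous.intervalIntegrable (by fun_prop) _ _) hin
  rw [intervalIntegral.integral_const, smul_eq_mul, intervalIntegral.integral_add,
    intervalIntegral.integral_sub, intervalIntegral.integral_const_mul,
    intervalIntegral.integral_const_mul, intervalIntegral.integral_const, smul_eq_mul] at hout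
  rotate_left
  · exact Continuous.intervalIntegrable (by fun_prop) _ _
  · exact Continuous.intervalIntegrable (by fun_prop) _ _
  · exact Continuous.intervalIntegrable (by fun_prop) _ _
  · exact Continuous.intervalIntegrable (by fun_prop) _ _
  have e : (2 * Real.pi)⁻¹ * A * A = A ^ 2 / (2 * Real.pi) := by field_simp
  rw [e, sub_le_iff_le_add, ← sub_le_iff_le_add', le_div_iff₀ (by positivity)]
  rw [← hA, ← hB] at hout
  nlinarith

/-- The point of the circle of radius `t` at angle `θ`. -/
def cpt (t θ : ℝ) : E2 := pt (t * Real.cos θ) (t * Real.sin θ)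

@[simp] lemma pt_zero (a b : ℝ) : (pt a b) 0 = a := rfl
@[simp] lemma pt_one (a b : ℝ) : (pt a b) 1 = b := rfl
@[simp] lemma cpt_zero (t θ : ℝ) : (cpt t θ) 0 = t * Real.cos θ := rfl
@[simp] lemma cpt_one (t θ : ℝ) : (cpt t θ) 1 = t * Real.sin θ := rfl

lemma norm_sq_E2 (x : E2) : ‖x‖ ^ 2 = x 0 ^ 2 + x 1 ^ 2 := by
  rw [EuclideanSpace.norm_sq_eq]; simp

lemma norm_sq_cpt (t θ : ℝ) : ‖cpt t θ‖ ^ 2 = t ^ 2 := by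
  rw [norm_sq_E2]
  simp only [cpt_zero, cpt_one]
  linear_combination t ^ 2 * Real.sin_sq_add_cos_sq θ

lemma norm_cpt {t : ℝ} (ht : 0 ≤ t) (θ : ℝ) : ‖cpt t θ‖ = t :=
  (pow_left_inj₀ (norm_nonneg _) ht two_ne_zero).1 (norm_sq_cpt t θ)

lemma continuous_cpt : Continuous fun p : ℝ × ℝ => cpt p.1 p.2 := by
  unfold cpt pt
  change Continuous fun p : ℝ × ℝ =>
    WithLp.toLp 2 ![p.1 * Real.cos p.2, p.1 * Real.sin p.2]
  refine (PiLp.continuous_toLp 2 _).comp ?_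
  refine continuous_pi fun i => ?_
  fin_cases i <;> simp <;> fun_prop

lemma hasDerivAt_cpt (t θ : ℝ) :
    HasDerivAt (fun s => cpt t s) (pt (-(t * Real.sin θ)) (t * Real.cos θ)) θ := by
  have h : HasDerivAt (fun s => ![t * Real.cos s, t * Real.sin s])
      (![-(t * Real.sin θ), t * Real.cos θ]) θ := by
    rw [hasDerivAt_pi]
    intro i
    fin_cases i
    · simpa using (Real.hasDerivAt_cos θ).const_mul t
    · simpa using (Real.hasDerivAt_sin θ).const_mul t
  exact ((PiLp.continuousLinearEquiv 2 ℝ (fun _ : Fin 2 => ℝ)).symm.hasFDerivAt).comp_hasDerivAt θ h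

lemma fderiv_eq_pds (f : E2 → ℝ) (x v : E2) :
    fderiv ℝ f x v = v 0 * pds 0 f x + v 1 * pds 1 f x := by
  have hv : v = v 0 • EuclideanSpace.single (0 : Fin 2) (1 : ℝ)
      + v 1 • EuclideanSpace.single (1 : Fin 2) (1 : ℝ) := by
    ext i
    fin_cases i <;> simp
  conv_lhs => rw [hv]
  simp [pds]

lemma hasDerivAt_circle (g : Sm) (t θ : ℝ) :
    HasDerivAt (fun s => g.1 (cpt t s)) ((Sm.Th g).1 (cpt t θ)) θ := by
  have h := (g.differentiable (cpt t θ)).hasFDerivAt.comp_hasDerivAt θ (hasDerivAt_cpt t θ)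
  have e : (Sm.Th g).1 (cpt t θ)
      = fderiv ℝ g.1 (cpt t θ) (pt (-(t * Real.sin θ)) (t * Real.cos θ)) := by
    rw [fderiv_eq_pds]
    simp [Sm.Th, Sm.D_val]
    ring
  rw [e]
  exact h

/-- The mean of `g` over the circle of radius `t`. -/
def circleMean (g : E2 → ℝ) (t : ℝ) : ℝ :=
  (2 * Real.pi)⁻¹ * ∫ θ in (-Real.pi)..Real.pi, g (cpt t θ)

lemma continuous_circleMean {g : E2 → ℝ} (hg : Continuous g) : Continuous (circleMean g) := by
  unfold circleMean
  refine continuous_const.mul ?_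
  exact intervalIntegral.continuous_parametric_intervalIntegral_of_continuous
    (f := fun t θ => g (cpt t θ)) (hg.comp continuous_cpt) continuous_const

lemma circleMean_Th (f : Sm) (t : ℝ) : circleMean (Sm.Th f).1 t = 0 := by
  unfold circleMean
  rw [intervalIntegral.integral_eq_sub_of_hasDerivAt (fun θ _ => hasDerivAt_circle f t θ)]
  · simp [cpt]
  · exact (((Sm.Th f).continuous.comp continuous_cpt).comp
      (Continuous.prodMk_right t)).intervalIntegrable _ _

lemma abs_circleMean_le {g : E2 → ℝ} {t C : ℝ} (h : ∀ θ, |g (cpt t θ)| ≤ C) :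
    |circleMean g t| ≤ C := by
  have hpi := Real.pi_pos
  unfold circleMean
  have := intervalIntegral.norm_integral_le_of_norm_le_const (a := -Real.pi) (b := Real.pi)
    (f := fun θ => g (cpt t θ)) (C := C) (fun θ _ => h θ)
  rw [abs_mul, abs_of_pos (by positivity)]
  rw [Real.norm_eq_abs, abs_of_pos (a := Real.pi - -Real.pi) (by linarith)] at this
  calc (2 * Real.pi)⁻¹ * _ ≤ (2 * Real.pi)⁻¹ * (C * (Real.pi - -Real.pi)) := by gcongr
    _ = C := by field_simp; ring

/-- A continuous compactly supported function with nonpositive circle integrals has nonpositive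
integral. -/
lemma integral_nonpos_of_circle {F : E2 → ℝ} (hF : Continuous F) {T : ℝ}
    (hT : ∀ x, T < ‖x‖ → F x = 0)
    (h : ∀ t, 0 < t → (∫ θ in (-Real.pi)..Real.pi, F (cpt t θ)) ≤ 0) :
    ∫ x, F x ≤ 0 := by
  have e1 : ∫ x, F x = ∫ z : ℂ, F (Complex.orthonormalBasisOneI.repr z) :=
    ((LinearIsometryEquiv.measurePreserving Complex.orthonormalBasisOneI.repr).integral_comp
      (Complex.orthonormalBasisOneI.repr.toHomeomorph.measurableEmbedding) F).symm
  rw [e1, ← Complex.integral_comp_polarCoord_symm]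
  have e2 : ∀ p : ℝ × ℝ,
      Complex.orthonormalBasisOneI.repr (Complex.polarCoord.symm p) = cpt p.1 p.2 := by
    intro p
    ext i
    rw [Complex.polarCoord_symm_apply]
    fin_cases i
    · simp [Complex.orthonormalBasisOneI_repr_apply, -Complex.ofReal_cos, -Complex.ofReal_sin]
    · simp [Complex.orthonormalBasisOneI_repr_apply, -Complex.ofReal_sin]
  simp_rw [e2]
  rw [polarCoord_target, Measure.volume_eq_prod, setIntegral_prod]
  · refine setIntegral_nonpos measurableSet_Ioi fun t ht => ?_
    have ht' : (0 : ℝ) < t := ht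
    simp only [smul_eq_mul]
    rw [integral_const_mul]
    refine mul_nonpos_of_nonneg_of_nonpos ht'.le ?_
    rw [← integral_Ioc_eq_integral_Ioo,
      ← intervalIntegral.integral_of_le (by linarith [Real.pi_pos])]
    exact h t ht'
  · have hc : Continuous fun p : ℝ × ℝ => p.1 • F (cpt p.1 p.2) :=
      continuous_fst.smul (hF.comp continuous_cpt)
    have hi : IntegrableOn (fun p : ℝ × ℝ => p.1 • F (cpt p.1 p.2))
        (Set.Icc 0 T ×ˢ Set.Icc (-Real.pi) Real.pi) (volume.prod volume) :=
      hc.continuousOn.integrableOn_compact (isCompact_Icc.prod isCompact_Icc)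
    refine IntegrableOn.of_forall_sdiff_eq_zero hi (measurableSet_Ioi.prod measurableSet_Ioo) ?_
    rintro ⟨t, θ⟩ ⟨⟨ht, hθ⟩, hn⟩
    have ht' : (0 : ℝ) < t := ht
    have : T < t := by
      by_contra hcon
      exact hn ⟨⟨ht'.le, not_lt.1 hcon⟩, ⟨hθ.1.le, hθ.2.le⟩⟩
    have := hT (cpt t θ) (by rwa [norm_cpt ht'.le])
    simp [this]

/-- A continuous function vanishing outside a disk is integrable. -/
lemma integrable_of_zero {F : E2 → ℝ} (hF : Continuous F) {T : ℝ}
    (hT : ∀ x, T < ‖x‖ → F x = 0) : Integrable F := by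
  refine hF.integrable_of_hasCompactSupport ?_
  refine HasCompactSupport.intro (isCompact_closedBall (0 : E2) T) fun x hx => hT x ?_
  simpa using hx

/-- A radially weighted continuous function is integrable if the weight vanishes far out. -/
lemma integrable_radial {k : ℝ → ℝ} (hk : Continuous k) {β : ℝ} (hβ : ∀ τ, β ≤ τ → k τ = 0)
    {G : E2 → ℝ} (hG : Continuous G) : Integrable fun x => k (‖x‖ ^ 2) * G x := by
  refine integrable_of_zero (T := Real.sqrt β) (by fun_prop) fun x hx => ?_
  have : β ≤ ‖x‖ ^ 2 := by
    by_contra h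
    have := Real.lt_sqrt (norm_nonneg x) |>.2 (not_le.1 h)
    linarith
  rw [hβ _ this, zero_mul]

/-- The circle Poincaré inequality integrated against a radial weight. -/
lemma radial_poincare {k : ℝ → ℝ} (hk : Continuous k) (hk0 : ∀ τ, 0 ≤ k τ) {β : ℝ}
    (hβ : ∀ τ, β ≤ τ → k τ = 0) (g : Sm) :
    ∫ x, k (‖x‖ ^ 2) * g.1 x ^ 2 ≤ (∫ x, k (‖x‖ ^ 2) * (circleMean g.1 ‖x‖ * g.1 x))
      + 2 * Real.pi ^ 2 * ∫ x, k (‖x‖ ^ 2) * (Sm.Th g).1 x ^ 2 := by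
  have c1 : Continuous g.1 := g.continuous
  have c2 : Continuous (Sm.Th g).1 := (Sm.Th g).continuous
  have c3 : Continuous (circleMean g.1) := continuous_circleMean c1
  rw [← sub_nonpos, sub_add_eq_sub_sub, ← integral_const_mul, ← integral_sub, ← integral_sub]
  rotate_left
  · exact (integrable_radial hk hβ (by fun_prop)).sub (integrable_radial hk hβ (by fun_prop))
  · exact (integrable_radial hk hβ (by fun_prop)).const_mul _
  · exact integrable_radial hk hβ (by fun_prop)
  · exact integrable_radial hk hβ (by fun_prop)
  refine integral_nonpos_of_circle (T := Real.sqrt β) (by fun_prop) ?_ ?_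
  · intro x hx
    have : β ≤ ‖x‖ ^ 2 := by
      by_contra h
      have := Real.lt_sqrt (norm_nonneg x) |>.2 (not_le.1 h)
      linarith
    simp [hβ _ this]
  · intro t ht
    have cc : Continuous fun θ => cpt t θ := continuous_cpt.comp (Continuous.prodMk_right t)
    simp_rw [norm_sq_cpt, norm_cpt ht.le]
    have := circle_poincare (fun θ => g.1 (cpt t θ)) _ (hasDerivAt_circle g t) (c2.comp cc)
    rw [intervalIntegral.integral_sub, intervalIntegral.integral_sub,
      intervalIntegral.integral_const_mul, intervalIntegral.integral_const_mul,
      intervalIntegral.integral_const_mul, intervalIntegral.integral_const_mul,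
      intervalIntegral.integral_const_mul]
    rotate_left
    · exact Continuous.intervalIntegrable (by fun_prop) _ _
    · exact Continuous.intervalIntegrable (by fun_prop) _ _
    · exact Continuous.intervalIntegrable (by fun_prop) _ _
    · exact Continuous.intervalIntegrable (by fun_prop) _ _
    have h2 := mul_nonneg (hk0 (t ^ 2)) (sub_nonneg.2 this)
    unfold circleMean
    beta_reduce at h2
    linarith

lemma hasFDerivAt_radial {φ : ℝ → ℝ} {d : ℝ} {x : E2} (h : HasDerivAt φ d (‖x‖ ^ 2)) :
    HasFDerivAt (fun y : E2 => φ (‖y‖ ^ 2)) (d • (2 • (innerSL ℝ x))) x :=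
  h.comp_hasFDerivAt x (hasStrictFDerivAt_norm_sq x).hasFDerivAt

/-- Divergence theorem for a smooth field against a compactly supported radial function. -/
lemma radial_divergence {φ φ' : ℝ → ℝ} (hφ : ∀ τ, HasDerivAt φ (φ' τ) τ) (hφ' : Continuous φ')
    {β : ℝ} (hβ : ∀ τ, β ≤ τ → φ τ = 0) (hβ' : ∀ τ, β ≤ τ → φ' τ = 0) (G₀ G₁ : Sm) :
    ∫ x, φ' (‖x‖ ^ 2) * (2 * (x 0 * G₀.1 x + x 1 * G₁.1 x))
      = -∫ x, φ (‖x‖ ^ 2) * (Sm.D 0 G₀ + Sm.D 1 G₁).1 x := by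
  have hφc : Continuous φ := continuous_iff_continuousAt.2 fun τ => (hφ τ).continuousAt
  have key : ∀ (α : Fin 2) (G : Sm), ∫ x, φ' (‖x‖ ^ 2) * (2 * (x α * G.1 x))
      = -∫ x, φ (‖x‖ ^ 2) * (Sm.D α G).1 x := by
    intro α G
    have cG := G.continuous
    have cD := (Sm.D α G).continuous
    have hfd : ∀ x : E2, fderiv ℝ (fun y : E2 => φ (‖y‖ ^ 2)) x (EuclideanSpace.single α 1)
        = φ' (‖x‖ ^ 2) * (2 * x α) := by
      intro x
      rw [(hasFDerivAt_radial (hφ _)).fderiv]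
      simp [EuclideanSpace.inner_single_right]
    have := integral_mul_fderiv_eq_neg_fderiv_mul_of_integrable (μ := (volume : Measure E2))
      (f := G.1) (g := fun y : E2 => φ (‖y‖ ^ 2)) (v := EuclideanSpace.single α 1) ?_ ?_ ?_
      (fun x _ => G.differentiable x) (fun x _ => (hasFDerivAt_radial (hφ _)).differentiableAt)
    · simp_rw [hfd] at this
      calc _ = ∫ x, G.1 x * (φ' (‖x‖ ^ 2) * (2 * x α)) := by congr 1; ext x; ring
        _ = _ := this
        _ = _ := by
          congr 2; ext x
          rw [mul_comm]; rfl
    · refine (integrable_radial hφc hβ cD).congr (Eventually.of_forall fun x => ?_)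
      simp only []
      rw [mul_comm]; rfl
    · simp_rw [hfd]
      refine (integrable_radial (G := fun x => 2 * x α * G.1 x) hφ' hβ' (by fun_prop)).congr
        (Eventually.of_forall fun x => ?_)
      simp only []
      ring
    · refine (integrable_radial hφc hβ cG).congr (Eventually.of_forall fun x => ?_)
      simp only []
      ring
  have c0 := G₀.continuous
  have c1 := G₁.continuous
  have d0 := (Sm.D 0 G₀).continuous
  have d1 := (Sm.D 1 G₁).continuous
  simp only [Sm.val_add, mul_add]
  rw [integral_add, integral_add, key, key, neg_add]
  · exact integrable_radial hφc hβ d0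
  · exact integrable_radial hφc hβ d1
  · exact integrable_radial (G := fun x => 2 * (x 0 * G₀.1 x)) hφ' hβ' (by fun_prop)
  · exact integrable_radial (G := fun x => 2 * (x 1 * G₁.1 x)) hφ' hβ' (by fun_prop)

lemma deriv_smoothTransition_of_nonpos {t : ℝ} (ht : t ≤ 0) :
    deriv Real.smoothTransition t = 0 := by
  refine IsLocalMin.deriv_eq_zero (Eventually.of_forall fun s => ?_)
  rw [Real.smoothTransition.zero_of_nonpos ht]
  exact Real.smoothTransition.nonneg s

lemma deriv_smoothTransition_of_one_le {t : ℝ} (ht : 1 ≤ t) :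
    deriv Real.smoothTransition t = 0 := by
  refine IsLocalMax.deriv_eq_zero (Eventually.of_forall fun s => ?_)
  rw [Real.smoothTransition.one_of_one_le ht]
  exact Real.smoothTransition.le_one s

lemma continuous_deriv_smoothTransition : Continuous (deriv Real.smoothTransition) :=
  (Real.smoothTransition.contDiff (n := 1)).continuous_deriv le_rfl

lemma exists_deriv_smoothTransition_le :
    ∃ C, 0 ≤ C ∧ ∀ t, |deriv Real.smoothTransition t| ≤ C := by
  obtain ⟨C, hC⟩ := isCompact_Icc (a := (0 : ℝ)) (b := 1) |>.exists_bound_of_continuousOn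
    continuous_deriv_smoothTransition.continuousOn
  refine ⟨C, (norm_nonneg _).trans (hC 0 (by simp)), fun t => ?_⟩
  by_cases h : t ∈ Set.Icc (0 : ℝ) 1
  · exact hC t h
  · have hC0 : 0 ≤ C := (norm_nonneg _).trans (hC 0 (by simp))
    rcases le_total t 0 with h0 | h0
    · rw [deriv_smoothTransition_of_nonpos h0]; simpa
    · rw [deriv_smoothTransition_of_one_le (by by_contra h1; exact h ⟨h0, (not_le.1 h1).le⟩)]
      simpa

/-- A smooth cutoff in `|x|²` adapted to the annulus `a ≤ |x| ≤ b`. -/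
structure IsCutoff (C a b : ℝ) (η η' : ℝ → ℝ) : Prop where
  hasDerivAt : ∀ τ, HasDerivAt η (η' τ) τ
  cont_deriv : Continuous η'
  nonneg : ∀ τ, 0 ≤ η τ
  le_one : ∀ τ, η τ ≤ 1
  zero_left : ∀ τ, τ ≤ a ^ 2 → η τ = 0
  zero_right : ∀ τ, b ^ 2 ≤ τ → η τ = 0
  deriv_left : ∀ τ, τ ≤ a ^ 2 → η' τ = 0
  deriv_right : ∀ τ, b ^ 2 ≤ τ → η' τ = 0
  eq_one : ∀ τ, 2 * a ^ 2 ≤ τ → τ ≤ b ^ 2 / 2 → η τ = 1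
  deriv_le : ∀ τ, η' τ = 0 ∨ (τ ≤ 2 * a ^ 2 ∧ |η' τ| ≤ C / a ^ 2) ∨ (τ ≤ b ^ 2 ∧ |η' τ| ≤ C / b ^ 2)

lemma exists_cutoff : ∃ C, 0 ≤ C ∧ ∀ a b : ℝ, 0 < a → 2 * a ≤ b → ∃ η η', IsCutoff C a b η η' := by
  obtain ⟨C, hC0, hC⟩ := exists_deriv_smoothTransition_le
  refine ⟨2 * C, by positivity, fun a b ha hab => ?_⟩
  have hb : 0 < b := by linarith
  have hab2 : 4 * a ^ 2 ≤ b ^ 2 := by nlinarith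
  have ha2 : 0 < a ^ 2 := by positivity
  have hb2 : 0 < b ^ 2 := by positivity
  set s := Real.smoothTransition with hs
  have hsd : ∀ t, HasDerivAt s (deriv s t) t := fun t =>
    ((Real.smoothTransition.contDiff (n := 1)).differentiable (by simp) t).hasDerivAt
  have f1 : ∀ τ, τ ≤ a ^ 2 → τ / a ^ 2 - 1 ≤ 0 := fun τ h => by
    rw [sub_nonpos, div_le_one ha2]; exact h
  have f2 : ∀ τ, 2 * a ^ 2 ≤ τ → 1 ≤ τ / a ^ 2 - 1 := fun τ h => by
    rw [le_sub_iff_add_le, le_div_iff₀ ha2]; linarith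
  have f3 : ∀ τ, b ^ 2 ≤ τ → 2 - 2 * τ / b ^ 2 ≤ 0 := fun τ h => by
    rw [sub_nonpos, le_div_iff₀ hb2]; linarith
  have f4 : ∀ τ, τ ≤ b ^ 2 / 2 → 1 ≤ 2 - 2 * τ / b ^ 2 := fun τ h => by
    rw [le_sub_comm, div_le_iff₀ hb2]; linarith
  refine ⟨fun τ => s (τ / a ^ 2 - 1) * s (2 - 2 * τ / b ^ 2),
    fun τ => deriv s (τ / a ^ 2 - 1) * (1 / a ^ 2) * s (2 - 2 * τ / b ^ 2)
      + s (τ / a ^ 2 - 1) * (deriv s (2 - 2 * τ / b ^ 2) * (-(2 / b ^ 2))), ?_⟩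
  constructor
  · intro τ
    have h1 : HasDerivAt (fun τ => τ / a ^ 2 - 1) (1 / a ^ 2) τ :=
      ((hasDerivAt_id τ).div_const _).sub_const _
    have h2 : HasDerivAt (fun τ => 2 - 2 * τ / b ^ 2) (-(2 / b ^ 2)) τ := by
      have := (((hasDerivAt_id τ).const_mul 2).div_const (b ^ 2)).const_sub 2
      simpa using this
    exact ((hsd _).comp τ h1).mul ((hsd _).comp τ h2)
  · have c1 := continuous_deriv_smoothTransition
    have c2 : Continuous s := Real.smoothTransition.continuous
    have c3 : Continuous (deriv s) := c1
    fun_prop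
  · exact fun τ => mul_nonneg (Real.smoothTransition.nonneg _) (Real.smoothTransition.nonneg _)
  · exact fun τ => mul_le_one₀ (Real.smoothTransition.le_one _) (Real.smoothTransition.nonneg _)
      (Real.smoothTransition.le_one _)
  · intro τ h
    rw [hs, Real.smoothTransition.zero_of_nonpos (f1 τ h), zero_mul]
  · intro τ h
    rw [hs, Real.smoothTransition.zero_of_nonpos (f3 τ h), mul_zero]
  · intro τ h
    rw [hs, Real.smoothTransition.zero_of_nonpos (f1 τ h),
      deriv_smoothTransition_of_nonpos (f1 τ h)]
    ring
  · intro τ h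
    rw [hs, Real.smoothTransition.zero_of_nonpos (f3 τ h),
      deriv_smoothTransition_of_nonpos (f3 τ h)]
    ring
  · intro τ h h'
    rw [hs, Real.smoothTransition.one_of_one_le (f2 τ h),
      Real.smoothTransition.one_of_one_le (f4 τ h'), one_mul]
  · intro τ
    have n1 := Real.smoothTransition.nonneg
    have n2 := Real.smoothTransition.le_one
    by_cases h1 : τ ≤ 2 * a ^ 2
    · right; left
      refine ⟨h1, ?_⟩
      have : deriv s (2 - 2 * τ / b ^ 2) = 0 :=
        deriv_smoothTransition_of_one_le (f4 τ (by linarith))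
      rw [this, zero_mul, mul_zero, add_zero, abs_mul, abs_mul, abs_of_nonneg (n1 _),
        abs_of_pos (a := 1 / a ^ 2) (by positivity)]
      calc _ ≤ C * (1 / a ^ 2) * 1 := by gcongr; exacts [n1 _, hC _, n2 _]
        _ ≤ 2 * C / a ^ 2 := by rw [mul_one, mul_one_div]; gcongr; linarith
    · have h1' : deriv s (τ / a ^ 2 - 1) = 0 :=
        deriv_smoothTransition_of_one_le (f2 τ (not_le.1 h1).le)
      by_cases h2 : τ ≤ b ^ 2
      · right; right
        refine ⟨h2, ?_⟩
        rw [h1', zero_mul, zero_mul, zero_add, abs_mul, abs_mul, abs_of_nonneg (n1 _), abs_neg,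
          abs_of_pos (a := 2 / b ^ 2) (by positivity)]
        calc _ ≤ 1 * (C * (2 / b ^ 2)) := by gcongr; exacts [n2 _, hC _]
          _ = 2 * C / b ^ 2 := by ring
      · left
        have : deriv s (2 - 2 * τ / b ^ 2) = 0 :=
          deriv_smoothTransition_of_nonpos (f3 τ (not_le.1 h2).le)
        rw [this, h1']; ring

namespace IsCutoff

variable {C a b : ℝ} {η η' : ℝ → ℝ}

lemma cont (hη : IsCutoff C a b η η') : Continuous η :=
  continuous_iff_continuousAt.2 fun τ => (hη.hasDerivAt τ).continuousAt

lemma deriv_mul_le (hη : IsCutoff C a b η η') (hC : 0 ≤ C) (ha : 0 < a) (hb : 0 < b) {τ : ℝ}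
    (hτ : 0 ≤ τ) : |η' τ| * τ ≤ 2 * C := by
  rcases hη.deriv_le τ with h | ⟨h, h'⟩ | ⟨h, h'⟩
  · rw [h]; simpa
  · calc |η' τ| * τ ≤ C / a ^ 2 * (2 * a ^ 2) := by gcongr
      _ = 2 * C := by field_simp
  · calc |η' τ| * τ ≤ C / b ^ 2 * b ^ 2 := by gcongr
      _ = C := by field_simp
      _ ≤ _ := by linarith

lemma integral_abs_deriv_le (hη : IsCutoff C a b η η') (hC : 0 ≤ C) (ha : 0 < a) (hb : 0 < b) :
    ∫ x : E2, |η' (‖x‖ ^ 2)| ≤ 3 * Real.pi * C := by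
  have hvol : ∀ ρ : ℝ, 0 ≤ ρ → (volume : Measure E2).real (closedBall 0 ρ) = ρ ^ 2 * Real.pi := by
    intro ρ hρ
    rw [Measure.real, EuclideanSpace.volume_closedBall_fin_two]
    simp [ENNReal.toReal_ofReal hρ, Real.pi_pos.le]
  have hInt : ∀ ρ c : ℝ, Integrable ((closedBall (0 : E2) ρ).indicator fun _ => c) :=
    fun ρ c => (integrable_indicator_iff measurableSet_closedBall).2
      (integrableOn_const (hs := measure_closedBall_lt_top.ne))
  have hval : ∀ ρ c : ℝ, 0 ≤ ρ →
      ∫ x, (closedBall (0 : E2) ρ).indicator (fun _ => c) x = ρ ^ 2 * Real.pi * c := by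
    intro ρ c hρ
    rw [integral_indicator measurableSet_closedBall, setIntegral_const, hvol ρ hρ, smul_eq_mul]
  have hmem : ∀ ρ τ c : ℝ, 0 ≤ ρ → ρ ^ 2 = τ → ∀ x : E2, ‖x‖ ^ 2 ≤ τ →
      (closedBall (0 : E2) ρ).indicator (fun _ => c) x = c := by
    intro ρ τ c hρ h x hx
    refine Set.indicator_of_mem ?_ _
    rw [mem_closedBall_zero_iff]
    exact (pow_le_pow_iff_left₀ (norm_nonneg _) hρ two_ne_zero).1 (hx.trans h.ge)
  have hnn : ∀ ρ c : ℝ, 0 ≤ c → ∀ x, 0 ≤ (closedBall (0 : E2) ρ).indicator (fun _ => c) x :=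
    fun ρ c hc x => Set.indicator_nonneg (fun _ _ => hc) x
  have hsq : (Real.sqrt 2 * a) ^ 2 = 2 * a ^ 2 := by
    rw [mul_pow, Real.sq_sqrt (by norm_num)]
  calc ∫ x : E2, |η' (‖x‖ ^ 2)|
      ≤ ∫ x, ((closedBall (0 : E2) (Real.sqrt 2 * a)).indicator (fun _ => C / a ^ 2) x
          + (closedBall (0 : E2) b).indicator (fun _ => C / b ^ 2) x) := by
        refine integral_mono_of_nonneg (Eventually.of_forall fun _ => abs_nonneg _)
          ((hInt _ _).add (hInt _ _)) (Eventually.of_forall fun x => ?_)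
        have n1 := hnn (Real.sqrt 2 * a) (C / a ^ 2) (by positivity) x
        have n2 := hnn b (C / b ^ 2) (by positivity) x
        simp only []
        rcases hη.deriv_le (‖x‖ ^ 2) with h | ⟨h, h'⟩ | ⟨h, h'⟩
        · rw [h, abs_zero]; positivity
        · rw [hmem _ _ _ (by positivity) hsq x h]; linarith
        · rw [hmem b _ _ hb.le rfl x h]; linarith
    _ = 3 * Real.pi * C := by
        rw [integral_add (hInt _ _) (hInt _ _), hval _ _ (by positivity), hval _ _ hb.le, hsq]
        field_simp
        ring

end IsCutoff

/-- Decay of order `|x|⁻⁴` outside the disk of radius `a` integrates to order `a⁻²`. -/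
lemma exists_integral_decay_le : ∃ K : ℝ, 0 ≤ K ∧ ∀ a : ℝ, 0 < a → ∀ C : ℝ, 0 ≤ C →
    ∀ F : E2 → ℝ, (∀ x, ‖x‖ ≤ a → F x = 0) → (∀ x, a ≤ ‖x‖ → |F x| * ‖x‖ ^ 4 ≤ C) →
    |∫ x, F x| ≤ C * K / a ^ 2 := by
  have hi : Integrable (fun x : E2 => (1 + ‖x‖) ^ (-4 : ℝ)) :=
    integrable_one_add_norm (by simp; norm_num)
  refine ⟨16 * ∫ x : E2, (1 + ‖x‖) ^ (-4 : ℝ), mul_nonneg (by norm_num)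
    (integral_nonneg fun x => by positivity), fun a ha C hC F h0 h1 => ?_⟩
  have hs : ∀ x : E2, ((1 + ‖x‖) ^ (-4 : ℝ)) = ((1 + ‖x‖) ^ 4)⁻¹ := by
    intro x
    rw [Real.rpow_neg (by positivity)]
    norm_cast
  have h2 : Integrable fun x : E2 => (16 * C / a ^ 4) * ((1 + ‖a⁻¹ • x‖) ^ (-4 : ℝ)) :=
    (hi.comp_smul (inv_ne_zero ha.ne')).const_mul _
  have h3 := norm_integral_le_of_norm_le (f := F) h2 (Eventually.of_forall fun x => ?_)
  · rw [integral_const_mul, Measure.integral_comp_inv_smul volume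
      (fun x : E2 => (1 + ‖x‖) ^ (-4 : ℝ)) a] at h3
    refine h3.trans (le_of_eq ?_)
    simp
    field_simp
  · rcases le_total ‖x‖ a with h | h
    · rw [h0 x h, norm_zero]; positivity
    · have hx : 0 < ‖x‖ := ha.trans_le h
      rw [hs, norm_smul, Real.norm_eq_abs, Real.norm_eq_abs, abs_of_pos (a := a⁻¹) (by positivity)]
      have e : (16 * C / a ^ 4) * ((1 + a⁻¹ * ‖x‖) ^ 4)⁻¹ = 16 * C / (a + ‖x‖) ^ 4 := by
        field_simp
      rw [e, le_div_iff₀ (by positivity)]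
      calc |F x| * (a + ‖x‖) ^ 4 ≤ |F x| * (2 * ‖x‖) ^ 4 := by gcongr; linarith
        _ = 16 * (|F x| * ‖x‖ ^ 4) := by ring
        _ ≤ 16 * C := by gcongr; exact h1 x h

/-- `g` is bounded by `C |x|ⁿ` at `x`. -/
def HB (x : E2) (n : ℤ) (C : ℝ) (g : Sm) : Prop := |g.1 x| ≤ C * ‖x‖ ^ n

namespace HB

variable {x : E2} {n m : ℤ} {C C' : ℝ} {f g : Sm}

lemma add (hf : HB x n C f) (hg : HB x n C' g) : HB x n (C + C') (f + g) := by
  unfold HB at *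
  rw [Sm.val_add, add_mul]
  exact (abs_add_le _ _).trans (add_le_add hf hg)

lemma neg (hf : HB x n C f) : HB x n C (-f) := by
  unfold HB at *
  rwa [Sm.val_neg, abs_neg]

lemma sub (hf : HB x n C f) (hg : HB x n C' g) : HB x n (C + C') (f - g) := by
  rw [sub_eq_add_neg]
  exact hf.add hg.neg

lemma mul (hx : x ≠ 0) (hf : HB x n C f) (hg : HB x m C' g) :
    HB x (n + m) (C * C') (f * g) := by
  unfold HB at *
  rw [Sm.val_mul, abs_mul, zpow_add₀ (norm_ne_zero_iff.2 hx), mul_mul_mul_comm]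
  exact mul_le_mul hf hg (abs_nonneg _) ((abs_nonneg _).trans hf)

lemma mono (hf : HB x n C f) (h : C ≤ C') : HB x n C' f := by
  unfold HB at *
  exact hf.trans (mul_le_mul_of_nonneg_right h (zpow_nonneg (norm_nonneg _) _))

lemma sum {ι : Type*} [Fintype ι] {f : ι → Sm} (h : ∀ i, HB x n C (f i)) :
    HB x n (Fintype.card ι * C) (∑ i, f i) := by
  unfold HB at *
  rw [Sm.val_sum]
  calc _ ≤ ∑ i, |(f i).1 x| := Finset.abs_sum_le_sum_abs _ _
    _ ≤ ∑ _i : ι, C * ‖x‖ ^ n := Finset.sum_le_sum fun i _ => h i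
    _ = _ := by simp [mul_assoc]

lemma X (α : Fin 2) : HB x 1 1 (Sm.X α) := by
  unfold HB
  simpa using PiLp.norm_apply_le x α

lemma Th (hx : x ≠ 0) (h : ∀ α, HB x n C (Sm.D α f)) : HB x (1 + n) (2 * C) (Sm.Th f) :=
  (((X 0).mul hx (h 1)).sub ((X 1).mul hx (h 0))).mono (by linarith)

lemma Eu (hx : x ≠ 0) (h : ∀ α, HB x n C (Sm.D α f)) : HB x (1 + n) (2 * C) (Sm.euler f) :=
  (((X 0).mul hx (h 0)).add ((X 1).mul hx (h 1))).mono (by linarith)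

lemma D_Th (hx : x ≠ 0) (h1 : ∀ α, HB x n C (Sm.D α f))
    (h2 : ∀ α β, HB x (-1 + n) C' (Sm.D α (Sm.D β f))) (α : Fin 2) :
    HB x n (2 * C' + C) (Sm.D α (Sm.Th f)) := by
  have key : ∀ β, HB x n (2 * C') (Sm.Th (Sm.D β f)) := fun β => by
    have := Th hx fun α => h2 α β
    rwa [show 1 + (-1 + n) = n by ring] at this
  fin_cases α
  · have e : Sm.D 0 (Sm.Th f) = Sm.Th (Sm.D 0 f) + Sm.D 1 f := by
      ext y; simp [Sm.Th]; ring
    change HB x n _ (Sm.D 0 (Sm.Th f))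
    rw [e]; exact (key 0).add (h1 1)
  · have e : Sm.D 1 (Sm.Th f) = Sm.Th (Sm.D 1 f) - Sm.D 0 f := by
      ext y; simp [Sm.Th]; ring
    change HB x n _ (Sm.D 1 (Sm.Th f))
    rw [e]; exact (key 1).sub (h1 0)

lemma DD_Th (hx : x ≠ 0) {C₁ C₂ : ℝ} (h2 : ∀ α β, HB x n C₁ (Sm.D α (Sm.D β f)))
    (h3 : ∀ α β γ, HB x (-1 + n) C₂ (Sm.D α (Sm.D β (Sm.D γ f)))) (α β : Fin 2) :
    HB x n (2 * C₂ + C₁ + C₁) (Sm.D α (Sm.D β (Sm.Th f))) := by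
  have key : ∀ α β, HB x n (2 * C₂ + C₁) (Sm.D α (Sm.Th (Sm.D β f))) := fun α β =>
    D_Th hx (fun α => h2 α β) (fun α γ => h3 α γ β) α
  fin_cases β
  · have e : Sm.D α (Sm.D 0 (Sm.Th f)) = Sm.D α (Sm.Th (Sm.D 0 f)) + Sm.D α (Sm.D 1 f) := by
      rw [← map_add]; congr 1; ext y; simp [Sm.Th]; ring
    change HB x n _ (Sm.D α (Sm.D 0 (Sm.Th f)))
    rw [e]; exact (key α 0).add (h2 α 1)
  · have e : Sm.D α (Sm.D 1 (Sm.Th f)) = Sm.D α (Sm.Th (Sm.D 1 f)) - Sm.D α (Sm.D 0 f) := by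
      rw [← map_sub]; congr 1; ext y; simp [Sm.Th]; ring
    change HB x n _ (Sm.D α (Sm.D 1 (Sm.Th f)))
    rw [e]; exact (key α 1).sub (h2 α 0)

end HB

/-- Bounds on the first three derivatives at a point. -/
structure DerivBd (x : E2) (f : Sm) : Prop where
  ne : x ≠ 0
  one : ∀ α, HB x (-1) 1 (Sm.D α f)
  two : ∀ α β, HB x (-2) 1 (Sm.D α (Sm.D β f))
  three : ∀ α β γ, HB x (-3) 1 (Sm.D α (Sm.D β (Sm.D γ f)))

namespace DerivBd

variable {x : E2} {f : Sm} (h : DerivBd x f)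
include h

lemma th : HB x 0 2 (Sm.Th f) := (HB.Th h.ne h.one).mono (by norm_num)
lemma eu : HB x 0 2 (Sm.euler f) := (HB.Eu h.ne h.one).mono (by norm_num)
lemma d_th (α : Fin 2) : HB x (-1) 3 (Sm.D α (Sm.Th f)) :=
  (HB.D_Th h.ne h.one h.two α).mono (by norm_num)
lemma th_th : HB x 0 6 (Sm.Th (Sm.Th f)) := (HB.Th h.ne h.d_th).mono (by norm_num)
lemma eu_th : HB x 0 6 (Sm.euler (Sm.Th f)) := (HB.Eu h.ne h.d_th).mono (by norm_num)
lemma d_th_th (α : Fin 2) : HB x (-1) 11 (Sm.D α (Sm.Th (Sm.Th f))) :=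
  (HB.D_Th h.ne h.d_th (HB.DD_Th h.ne h.two h.three) α).mono (by norm_num)
lemma lap : HB x (-2) 2 (Sm.L f) := ((h.two 0 0).add (h.two 1 1)).mono (by norm_num)
lemma d_lap (α : Fin 2) : HB x (-3) 2 (Sm.D α (Sm.L f)) := by
  unfold Sm.L
  rw [map_add]
  exact ((h.three α 0 0).add (h.three α 1 1)).mono (by norm_num)
lemma eu_lap : HB x (-2) 4 (Sm.euler (Sm.L f)) := (HB.Eu h.ne h.d_lap).mono (by norm_num)

end DerivBd

/-- Weights admissible for radial integration: continuous and vanishing for large argument. -/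
def Nice (k : ℝ → ℝ) : Prop := Continuous k ∧ ∃ β, ∀ τ, β ≤ τ → k τ = 0

lemma Nice.integrable {k : ℝ → ℝ} (hk : Nice k) (G : Sm) :
    Integrable fun x => k (‖x‖ ^ 2) * G.1 x := by
  obtain ⟨hc, β, hβ⟩ := hk
  exact integrable_radial hc hβ G.continuous

/-- Integration against a radial weight. -/
def Iop {k : ℝ → ℝ} (hk : Nice k) : Sm →ₗ[ℝ] ℝ where
  toFun G := ∫ x, k (‖x‖ ^ 2) * G.1 x
  map_add' G H := by
    simp only [Sm.val_add, mul_add]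
    exact integral_add (hk.integrable G) (hk.integrable H)
  map_smul' c G := by
    simp only [Sm.val_smul, RingHom.id_apply, smul_eq_mul]
    rw [← integral_const_mul]
    congr 1; ext x; ring

lemma Iop_apply {k : ℝ → ℝ} (hk : Nice k) (G : Sm) : Iop hk G = ∫ x, k (‖x‖ ^ 2) * G.1 x := rfl

lemma Iop_mono {k k' : ℝ → ℝ} (hk : Nice k) (hk' : Nice k') {G H : Sm}
    (h : ∀ x : E2, k (‖x‖ ^ 2) * G.1 x ≤ k' (‖x‖ ^ 2) * H.1 x) : Iop hk G ≤ Iop hk' H :=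
  integral_mono (hk.integrable G) (hk'.integrable H) h

lemma Iop_congr {k : ℝ → ℝ} (hk : Nice k) {G H : Sm}
    (h : ∀ x : E2, k (‖x‖ ^ 2) ≠ 0 → G.1 x = H.1 x) : Iop hk G = Iop hk H := by
  rw [Iop_apply, Iop_apply]
  congr 1; ext x
  by_cases hx : k (‖x‖ ^ 2) = 0
  · rw [hx, zero_mul, zero_mul]
  · rw [h x hx]

lemma Iop_nonneg {k : ℝ → ℝ} (hk : Nice k) (hk0 : ∀ τ, 0 ≤ k τ) {G : Sm}
    (h : ∀ x : E2, 0 ≤ G.1 x) : 0 ≤ Iop hk G :=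
  integral_nonneg fun x => mul_nonneg (hk0 _) (h x)

lemma Iop_divergence {φ φ' : ℝ → ℝ} (hφ : ∀ τ, HasDerivAt φ (φ' τ) τ) (hn : Nice φ)
    (hn' : Nice φ') (G₀ G₁ : Sm) :
    Iop hn' (Sm.X 0 * G₀ + Sm.X 1 * G₁) = -(1 / 2) * Iop hn (Sm.D 0 G₀ + Sm.D 1 G₁) := by
  obtain ⟨-, β, hβ⟩ := id hn
  obtain ⟨-, β', hβ'⟩ := id hn'
  have := radial_divergence hφ hn'.1 (fun τ h => hβ τ ((le_max_left β β').trans h))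
    (fun τ h => hβ' τ ((le_max_right β β').trans h)) G₀ G₁
  have e : (2 : ℝ) * Iop hn' (Sm.X 0 * G₀ + Sm.X 1 * G₁)
      = ∫ x, φ' (‖x‖ ^ 2) * (2 * (x 0 * G₀.1 x + x 1 * G₁.1 x)) := by
    rw [Iop_apply, ← integral_const_mul]
    congr 1; ext x
    simp
    ring
  rw [this] at e
  rw [Iop_apply hn]
  linarith

/-- A weighted integral with an integrand of order `|x|⁻⁴` on `|x| ≥ a` is of order `a⁻²`. -/
lemma exists_Iop_decay : ∃ K : ℝ, 0 ≤ K ∧ ∀ (k : ℝ → ℝ) (hk : Nice k) (a : ℝ), 0 < a →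
    (∀ τ, τ ≤ a ^ 2 → k τ = 0) → ∀ (C : ℝ), 0 ≤ C → ∀ (G : Sm),
    (∀ x : E2, a ≤ ‖x‖ → k (‖x‖ ^ 2) ≠ 0 → |k (‖x‖ ^ 2)| * |G.1 x| * ‖x‖ ^ 4 ≤ C) →
    |Iop hk G| ≤ C * K / a ^ 2 := by
  obtain ⟨K, hK, h⟩ := exists_integral_decay_le
  refine ⟨K, hK, fun k hk a ha h0 C hC G hG => h a ha C hC _ (fun x hx => ?_) fun x hx => ?_⟩
  · rw [h0 _ (by gcongr), zero_mul]
  · rw [abs_mul]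
    by_cases h1 : k (‖x‖ ^ 2) = 0
    · rw [h1]; simpa
    · exact hG x hx h1

lemma Sm.D_eq_zero {ρ : ℝ} {g : Sm} (h : ∀ x ∈ ball (0 : E2) ρ, g.1 x = 0) (α : Fin 2) :
    ∀ x ∈ ball (0 : E2) ρ, (Sm.D α g).1 x = 0 := by
  intro x hx
  have : g.1 =ᶠ[nhds x] fun _ => 0 := by
    filter_upwards [isOpen_ball.mem_nhds hx] with y hy using h y hy
  rw [Sm.D_val, pds, this.fderiv_eq]
  simp

lemma Sm.Th_eq_zero {ρ : ℝ} {g : Sm} (h : ∀ x ∈ ball (0 : E2) ρ, g.1 x = 0) :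
    ∀ x ∈ ball (0 : E2) ρ, (Sm.Th g).1 x = 0 := by
  intro x hx
  simp [Sm.Th, Sm.D_eq_zero h _ x hx]

/-- A smooth family solving the sphere-valued `ε`-harmonic map equation, with scale-invariant
derivative bounds and small scale-invariant gradient on the annulus `a ≤ |x| ≤ b`. -/
structure Neck {ι : Type*} [Fintype ι] (f : ι → Sm) (ε a b : ℝ) : Prop where
  eps_pos : 0 < ε
  a_pos : 0 < a
  two_a_le : 2 * a ≤ b
  b_lt : b < 1 / 2
  sphere : ∀ x ∈ ball (0 : E2) (1 / 2), ∑ i, (f i).1 x ^ 2 = 1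
  eqn : ∀ x ∈ ball (0 : E2) (1 / 2), ∃ c : ℝ, ∀ i,
    (Sm.L (f i) - ε • Sm.L (Sm.L (f i))).1 x = c * (f i).1 x
  bd : ∀ x : E2, a ≤ ‖x‖ → ‖x‖ ≤ b → ∀ i, DerivBd x (f i)
  small : ∀ x : E2, a ≤ ‖x‖ → ‖x‖ ≤ b →
    (∑ i, ((Sm.D 0 (f i)).1 x ^ 2 + (Sm.D 1 (f i)).1 x ^ 2)) * ‖x‖ ^ 2 * 40 ≤ 1

namespace Neck

variable {ι : Type*} [Fintype ι] {f : ι → Sm} {ε a b : ℝ} (N : Neck f ε a b)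
include N

lemma b_pos : 0 < b := by linarith [N.a_pos, N.two_a_le]

lemma sum_mul_D (α : Fin 2) :
    ∀ x ∈ ball (0 : E2) (1 / 2), ∑ i, (f i).1 x * (Sm.D α (f i)).1 x = 0 := by
  intro x hx
  have := Sm.D_eq_zero (g := ∑ i, f i * f i - 1) (fun y hy => by
    simp [← N.sphere y hy, pow_two]) α x hx
  simp [Finset.sum_add_distrib] at this
  linarith

lemma sum_mul_Th : ∀ x ∈ ball (0 : E2) (1 / 2), ∑ i, (f i).1 x * (Sm.Th (f i)).1 x = 0 := by
  intro x hx
  have h0 := N.sum_mul_D 0 x hx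
  have h1 := N.sum_mul_D 1 x hx
  calc _ = x 0 * (∑ i, (f i).1 x * (Sm.D 1 (f i)).1 x)
        - x 1 * ∑ i, (f i).1 x * (Sm.D 0 (f i)).1 x := by
        rw [Finset.mul_sum, Finset.mul_sum, ← Finset.sum_sub_distrib]
        refine Finset.sum_congr rfl fun i _ => ?_
        simp [Sm.Th]; ring
    _ = 0 := by rw [h0, h1]; ring

lemma sum_mul_Eu : ∀ x ∈ ball (0 : E2) (1 / 2), ∑ i, (f i).1 x * (Sm.euler (f i)).1 x = 0 := by
  intro x hx
  have h0 := N.sum_mul_D 0 x hx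
  have h1 := N.sum_mul_D 1 x hx
  calc _ = x 0 * (∑ i, (f i).1 x * (Sm.D 0 (f i)).1 x)
        + x 1 * ∑ i, (f i).1 x * (Sm.D 1 (f i)).1 x := by
        rw [Finset.mul_sum, Finset.mul_sum, ← Finset.sum_add_distrib]
        refine Finset.sum_congr rfl fun i _ => ?_
        simp [Sm.euler]; ring
    _ = 0 := by rw [h0, h1]; ring

lemma sum_mul_Th_Th : ∀ x ∈ ball (0 : E2) (1 / 2),
    ∑ i, (f i).1 x * (Sm.Th (Sm.Th (f i))).1 x = -∑ i, (Sm.Th (f i)).1 x ^ 2 := by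
  intro x hx
  have := Sm.Th_eq_zero (g := ∑ i, f i * Sm.Th (f i)) (fun y hy => by
    simpa using N.sum_mul_Th y hy) x hx
  have e : Sm.Th (∑ i, f i * Sm.Th (f i)) = ∑ i, (f i * Sm.Th (Sm.Th (f i)) + Sm.Th (f i) ^ 2) := by
    ext y
    simp [Sm.Th, Finset.mul_sum, ← Finset.sum_sub_distrib]
    refine Finset.sum_congr rfl fun i _ => ?_
    ring
  rw [e] at this
  simp [Finset.sum_add_distrib] at this
  linarith

lemma sum_mul_L : ∀ x ∈ ball (0 : E2) (1 / 2), ∑ i, (f i).1 x * (Sm.L (f i)).1 x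
    = -∑ i, ((Sm.D 0 (f i)).1 x ^ 2 + (Sm.D 1 (f i)).1 x ^ 2) := by
  intro x hx
  have key : ∀ α, ∑ i, (f i).1 x * (Sm.D α (Sm.D α (f i))).1 x
      = -∑ i, (Sm.D α (f i)).1 x ^ 2 := by
    intro α
    have := Sm.D_eq_zero (g := ∑ i, f i * Sm.D α (f i)) (fun y hy => by
      simpa using N.sum_mul_D α y hy) α x hx
    simp [Finset.sum_add_distrib] at this
    simp only [pow_two]
    linarith
  have h0 := key 0
  have h1 := key 1
  simp [Sm.L, mul_add, Finset.sum_add_distrib]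
  linarith

lemma abs_le_one (i : ι) : ∀ x ∈ ball (0 : E2) (1 / 2), |(f i).1 x| ≤ 1 := by
  intro x hx
  rw [← sq_le_one_iff_abs_le_one, ← N.sphere x hx]
  exact Finset.single_le_sum (f := fun i => (f i).1 x ^ 2) (fun i _ => sq_nonneg _)
    (Finset.mem_univ i)

/-- Testing the equation with a family orthogonal to the map. -/
lemma test {x : E2} (hx : x ∈ ball (0 : E2) (1 / 2)) {g : ι → ℝ} (hg : ∑ i, g i * (f i).1 x = 0) :
    ∑ i, g i * (Sm.L (f i) - ε • Sm.L (Sm.L (f i))).1 x = 0 := by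
  obtain ⟨c, hc⟩ := N.eqn x hx
  calc _ = c * ∑ i, g i * (f i).1 x := by
        rw [Finset.mul_sum]
        exact Finset.sum_congr rfl fun i _ => by rw [hc]; ring
    _ = 0 := by rw [hg, mul_zero]

end Neck

lemma Sm.sq_add_sq (g : Sm) (x : E2) : (Sm.euler g).1 x ^ 2 + (Sm.Th g).1 x ^ 2
    = ‖x‖ ^ 2 * ((Sm.D 0 g).1 x ^ 2 + (Sm.D 1 g).1 x ^ 2) := by
  rw [norm_sq_E2]
  simp [Sm.euler, Sm.Th]
  ring

namespace IsCutoff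

variable {C a b : ℝ} {η η' : ℝ → ℝ} (hη : IsCutoff C a b η η')
include hη

lemma nice : Nice η := ⟨hη.cont, b ^ 2, hη.zero_right⟩

lemma nice_deriv : Nice η' := ⟨hη.cont_deriv, b ^ 2, hη.deriv_right⟩

lemma abs_Iop_deriv_le (hC : 0 ≤ C) (ha : 0 < a) (hb : 0 < b) {M : ℝ} (hM : 0 ≤ M) {G : Sm}
    (hG : ∀ x : E2, η' (‖x‖ ^ 2) ≠ 0 → |G.1 x| ≤ M) :
    |Iop hη.nice_deriv G| ≤ M * (3 * Real.pi * C) := by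
  have hi : Integrable fun x : E2 => |η' (‖x‖ ^ 2)| := by
    simpa using (hη.nice_deriv.integrable 1).abs
  calc |Iop hη.nice_deriv G| ≤ ∫ x : E2, M * |η' (‖x‖ ^ 2)| := by
        rw [Iop_apply, ← Real.norm_eq_abs]
        refine norm_integral_le_of_norm_le (hi.const_mul M) (Eventually.of_forall fun x => ?_)
        rw [Real.norm_eq_abs, abs_mul, mul_comm]
        by_cases h : η' (‖x‖ ^ 2) = 0
        · simp [h]
        · exact mul_le_mul_of_nonneg_right (hG x h) (abs_nonneg _)
    _ ≤ _ := by
        rw [integral_const_mul]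
        exact mul_le_mul_of_nonneg_left (hη.integral_abs_deriv_le hC ha hb) hM

end IsCutoff

/-- The scale-invariant weight `η(τ) / τ`. -/
def wt (a : ℝ) (η : ℝ → ℝ) (τ : ℝ) : ℝ := η τ / max τ (a ^ 2)

namespace IsCutoff

variable {C a b : ℝ} {η η' : ℝ → ℝ} (hη : IsCutoff C a b η η') (ha : 0 < a)
include hη

lemma wt_zero_left {τ : ℝ} (h : τ ≤ a ^ 2) : wt a η τ = 0 := by
  rw [wt, hη.zero_left τ h, zero_div]

lemma wt_zero_right {τ : ℝ} (h : b ^ 2 ≤ τ) : wt a η τ = 0 := by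
  rw [wt, hη.zero_right τ h, zero_div]

include ha

lemma nice_wt : Nice (wt a η) := by
  refine ⟨?_, b ^ 2, fun τ h => hη.wt_zero_right h⟩
  unfold wt
  exact hη.cont.div (by fun_prop) fun τ => (lt_max_of_lt_right (by positivity)).ne'

lemma wt_nonneg (τ : ℝ) : 0 ≤ wt a η τ :=
  div_nonneg (hη.nonneg τ) (le_max_of_le_right (by positivity))

lemma wt_mul (τ : ℝ) : wt a η τ * τ = η τ := by
  rcases le_total τ (a ^ 2) with h | h
  · rw [hη.wt_zero_left h, hη.zero_left τ h, zero_mul]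
  · have : 0 < τ := (by positivity : 0 < a ^ 2).trans_le h
    rw [wt, max_eq_left h, div_mul_cancel₀ _ this.ne']

lemma wt_mul_le (τ : ℝ) : wt a η τ * τ ≤ 1 := (hη.wt_mul ha τ).trans_le (hη.le_one τ)

end IsCutoff

/-- The pointwise squared gradient of a smooth function. -/
def Sm.gs (g : Sm) : Sm := Sm.D 0 g * Sm.D 0 g + Sm.D 1 g * Sm.D 1 g

lemma Sm.gs_nonneg (g : Sm) (x : E2) : 0 ≤ (Sm.gs g).1 x := by
  simp only [Sm.gs, Sm.val_add, Sm.val_mul]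
  nlinarith [sq_nonneg ((Sm.D 0 g).1 x), sq_nonneg ((Sm.D 1 g).1 x)]

lemma norm_bounds_of_sq {a b : ℝ} (hb : 0 < b) {x : E2} (h : ¬ ‖x‖ ^ 2 ≤ a ^ 2)
    (h' : ¬ b ^ 2 ≤ ‖x‖ ^ 2) : a ≤ ‖x‖ ∧ ‖x‖ ≤ b := by
  have hn := norm_nonneg x
  constructor
  · by_contra hc; exact h (by gcongr; exact (not_le.1 hc).le)
  · by_contra hc; exact h' (by gcongr; exact (not_le.1 hc).le)

namespace IsCutoff

variable {C a b : ℝ} {η η' : ℝ → ℝ} (hη : IsCutoff C a b η η') (ha : 0 < a) (hb : 0 < b)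
include hη

section

include hb

lemma bounds {x : E2} (h : η (‖x‖ ^ 2) ≠ 0) : a ≤ ‖x‖ ∧ ‖x‖ ≤ b :=
  norm_bounds_of_sq hb (fun h1 => h (hη.zero_left _ h1)) fun h1 => h (hη.zero_right _ h1)

lemma bounds_deriv {x : E2} (h : η' (‖x‖ ^ 2) ≠ 0) : a ≤ ‖x‖ ∧ ‖x‖ ≤ b :=
  norm_bounds_of_sq hb (fun h1 => h (hη.deriv_left _ h1)) fun h1 => h (hη.deriv_right _ h1)

lemma bounds_wt {x : E2} (h : wt a η (‖x‖ ^ 2) ≠ 0) : a ≤ ‖x‖ ∧ ‖x‖ ≤ b :=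
  norm_bounds_of_sq hb (fun h1 => h (hη.wt_zero_left h1)) fun h1 => h (hη.wt_zero_right h1)

end

include ha

/-- Hardy-type comparison of the angular and radial derivatives with the gradient. -/
lemma Iop_wt_sq_le (g : Sm) : Iop (hη.nice_wt ha) (Sm.Th g * Sm.Th g) ≤ Iop hη.nice (Sm.gs g)
    ∧ Iop (hη.nice_wt ha) (Sm.euler g * Sm.euler g) ≤ Iop hη.nice (Sm.gs g) := by
  have key : ∀ x : E2, η (‖x‖ ^ 2) * (Sm.gs g).1 x
      = wt a η (‖x‖ ^ 2) * ((Sm.euler g).1 x ^ 2 + (Sm.Th g).1 x ^ 2) := by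
    intro x
    rw [Sm.sq_add_sq, ← mul_assoc, hη.wt_mul ha]
    simp [Sm.gs]; left; ring
  constructor <;>
  · refine Iop_mono _ _ fun x => ?_
    rw [key]
    refine mul_le_mul_of_nonneg_left ?_ (hη.wt_nonneg ha _)
    simp only [Sm.val_mul]
    nlinarith [sq_nonneg ((Sm.euler g).1 x), sq_nonneg ((Sm.Th g).1 x)]

lemma Iop_poincare_Th (f : Sm) : Iop (hη.nice_wt ha) (Sm.Th f * Sm.Th f)
    ≤ 20 * Iop hη.nice (Sm.gs (Sm.Th f)) := by
  have h1 := radial_poincare (hη.nice_wt ha).1 (hη.wt_nonneg ha) (β := b ^ 2)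
    (fun τ h => hη.wt_zero_right h) (Sm.Th f)
  simp only [circleMean_Th, zero_mul, mul_zero, integral_zero, zero_add] at h1
  have h2 := (hη.Iop_wt_sq_le ha (Sm.Th f)).1
  have e : ∀ g : Sm, Iop (hη.nice_wt ha) (g * g) = ∫ x, wt a η (‖x‖ ^ 2) * g.1 x ^ 2 := by
    intro g
    simp [Iop_apply, pow_two]
  rw [← e, ← e] at h1
  have h3 : 0 ≤ Iop hη.nice (Sm.gs (Sm.Th f)) := Iop_nonneg _ hη.nonneg (Sm.gs_nonneg _)
  have hpi : Real.pi ^ 2 ≤ 10 := by nlinarith [Real.pi_lt_d2, Real.pi_pos]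
  calc _ ≤ 2 * Real.pi ^ 2 * Iop (hη.nice_wt ha) (Sm.Th (Sm.Th f) * Sm.Th (Sm.Th f)) := h1
    _ ≤ 2 * Real.pi ^ 2 * Iop hη.nice (Sm.gs (Sm.Th f)) := by gcongr
    _ ≤ _ := by nlinarith

end IsCutoff

namespace IsCutoff

variable {C a b : ℝ} {η η' : ℝ → ℝ} (hη : IsCutoff C a b η η')
include hη

lemma Iop_L_mul_Th_Th (f : Sm) : Iop hη.nice (Sm.L f * Sm.Th (Sm.Th f))
    = Iop hη.nice (Sm.gs (Sm.Th f)) + 2 * Iop hη.nice_deriv (Sm.Th f * Sm.euler (Sm.Th f)) := by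
  have h1 := Iop_divergence hη.hasDerivAt hη.nice hη.nice_deriv
    (-(Sm.X 1 * (Sm.L f * Sm.Th f)) - Sm.Th f * Sm.D 0 (Sm.Th f))
    (Sm.X 0 * (Sm.L f * Sm.Th f) - Sm.Th f * Sm.D 1 (Sm.Th f))
  have e : Sm.X 0 * (-(Sm.X 1 * (Sm.L f * Sm.Th f)) - Sm.Th f * Sm.D 0 (Sm.Th f))
      + Sm.X 1 * (Sm.X 0 * (Sm.L f * Sm.Th f) - Sm.Th f * Sm.D 1 (Sm.Th f))
      = -(Sm.Th f * Sm.euler (Sm.Th f)) := by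
    rw [Sm.euler]; ring
  rw [e, Sm.div_angular, map_neg, map_sub] at h1
  rw [Sm.gs]
  linarith

lemma Iop_mul_L (g w : Sm) : Iop hη.nice (g * Sm.L w)
    = -2 * Iop hη.nice_deriv (g * Sm.euler w)
      - Iop hη.nice (Sm.D 0 g * Sm.D 0 w + Sm.D 1 g * Sm.D 1 w) := by
  have h1 := Iop_divergence hη.hasDerivAt hη.nice hη.nice_deriv (g * Sm.D 0 w) (g * Sm.D 1 w)
  have e : Sm.X 0 * (g * Sm.D 0 w) + Sm.X 1 * (g * Sm.D 1 w) = g * Sm.euler w := by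
    rw [Sm.euler]; ring
  rw [e, Sm.div_green, map_add] at h1
  linarith

end IsCutoff

lemma HB.abs_le {x : E2} {C : ℝ} {f : Sm} (h : HB x 0 C f) : |f.1 x| ≤ C := by
  simpa [HB] using h

lemma HB.abs_mul_pow_le {x : E2} {C : ℝ} {f : Sm} (hx : x ≠ 0) (n : ℕ) (h : HB x (-n) C f) :
    |f.1 x| * ‖x‖ ^ n ≤ C := by
  have : 0 < ‖x‖ := norm_pos_iff.2 hx
  unfold HB at h
  rw [zpow_neg, zpow_natCast] at h
  calc _ ≤ C * (‖x‖ ^ n)⁻¹ * ‖x‖ ^ n := by gcongr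
    _ = C := by field_simp

namespace Neck

variable {ι : Type*} [Fintype ι] {f : ι → Sm} {ε a b : ℝ} (N : Neck f ε a b)
include N

lemma mem_ball {x : E2} (h : ‖x‖ ≤ b) : x ∈ ball (0 : E2) (1 / 2) := by
  rw [mem_ball_zero_iff]
  linarith [N.b_lt]

lemma hb_self {x : E2} (h : ‖x‖ ≤ b) (i : ι) : HB x 0 1 (f i) := by
  simpa [HB] using N.abs_le_one i x (N.mem_ball h)

end Neck

/-- The angular test family. -/
def angTest {ι : Type*} [Fintype ι] (f : ι → Sm) (i : ι) : Sm :=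
  Sm.Th (Sm.Th (f i)) + (∑ k, Sm.Th (f k) * Sm.Th (f k)) * f i

namespace Neck

variable {ι : Type*} [Fintype ι] {f : ι → Sm} {ε a b : ℝ} (N : Neck f ε a b)
include N

lemma sum_angTest {x : E2} (hx : x ∈ ball (0 : E2) (1 / 2)) :
    ∑ i, (Sm.L (f i)).1 x * (Sm.Th (Sm.Th (f i))).1 x
      = (∑ k, (Sm.Th (f k)).1 x ^ 2) * (∑ i, ((Sm.D 0 (f i)).1 x ^ 2 + (Sm.D 1 (f i)).1 x ^ 2))
        + ε * ∑ i, (angTest f i).1 x * (Sm.L (Sm.L (f i))).1 x := by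
  set S := ∑ k, (Sm.Th (f k)).1 x ^ 2 with hS
  have e : ∀ i, (angTest f i).1 x = (Sm.Th (Sm.Th (f i))).1 x + S * (f i).1 x := by
    intro i
    simp [angTest, hS, pow_two]
  have h1 := N.test hx (g := fun i => (angTest f i).1 x) (by
    simp only [e, add_mul, Finset.sum_add_distrib]
    have h2 := N.sum_mul_Th_Th x hx
    have h3 : ∑ i, S * (f i).1 x * (f i).1 x = S * ∑ i, (f i).1 x ^ 2 := by
      rw [Finset.mul_sum]; exact Finset.sum_congr rfl fun i _ => by ring
    rw [h3, N.sphere x hx]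
    rw [← hS] at h2
    rw [← neg_add_eq_zero] at h2
    simp only [mul_comm ((f _).1 x)] at h2
    linarith)
  have h4 : ∑ i, (angTest f i).1 x * (Sm.L (f i)).1 x
      = ∑ i, (Sm.L (f i)).1 x * (Sm.Th (Sm.Th (f i))).1 x
        + S * ∑ i, (f i).1 x * (Sm.L (f i)).1 x := by
    rw [Finset.mul_sum, ← Finset.sum_add_distrib]
    exact Finset.sum_congr rfl fun i _ => by rw [e]; ring
  have h5 := N.sum_mul_L x hx
  simp only [Sm.val_sub, Sm.val_smul, mul_sub, Finset.sum_sub_distrib] at h1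
  rw [h4, h5] at h1
  have h6 : ∑ i, (angTest f i).1 x * (ε * (Sm.L (Sm.L (f i))).1 x)
      = ε * ∑ i, (angTest f i).1 x * (Sm.L (Sm.L (f i))).1 x := by
    rw [Finset.mul_sum]; exact Finset.sum_congr rfl fun i _ => by ring
  rw [h6] at h1
  linarith

lemma hb_angTest {x : E2} (h : a ≤ ‖x‖) (h' : ‖x‖ ≤ b) (i : ι) :
    HB x 0 (6 + 4 * Fintype.card ι) (angTest f i) := by
  have d := N.bd x h h'
  have hx := (d i).ne
  exact ((d i).th_th.add ((HB.sum fun k => (d k).th.mul hx (d k).th).mul hx (N.hb_self h' i))).mono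
    (by linarith)

lemma hb_D_angTest {x : E2} (h : a ≤ ‖x‖) (h' : ‖x‖ ≤ b) (i : ι) (α : Fin 2) :
    HB x (-1) (11 + 16 * Fintype.card ι) (Sm.D α (angTest f i)) := by
  have d := N.bd x h h'
  have hx := (d i).ne
  have e : Sm.D α (angTest f i) = Sm.D α (Sm.Th (Sm.Th (f i)))
      + ((∑ k, Sm.Th (f k) * Sm.Th (f k)) * Sm.D α (f i)
        + f i * ∑ k, (Sm.Th (f k) * Sm.D α (Sm.Th (f k))
          + Sm.Th (f k) * Sm.D α (Sm.Th (f k)))) := by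
    rw [angTest, map_add, Sm.D_mul, map_sum]
    simp only [Sm.D_mul]
  rw [e]
  exact (((d i).d_th_th α).add (((HB.sum fun k => (d k).th.mul hx (d k).th).mul hx
    ((d i).one α)).add ((N.hb_self h' i).mul hx (HB.sum fun k =>
      ((d k).th.mul hx ((d k).d_th α)).add ((d k).th.mul hx ((d k).d_th α)))))).mono (by linarith)

end Neck

lemma IsCutoff.abs_deriv_mul_sq_le {C a b : ℝ} {η η' : ℝ → ℝ} (hη : IsCutoff C a b η η')
    (hC : 0 ≤ C) (ha : 0 < a) (hb : 0 < b) (x : E2) : |η' (‖x‖ ^ 2)| * ‖x‖ ^ 2 ≤ 2 * C :=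
  hη.deriv_mul_le hC ha hb (by positivity)

/-- The angular energy on the neck is bounded. -/
lemma exists_angular_bound (ι : Type*) [Fintype ι] {C₀ : ℝ} (hC₀ : 0 ≤ C₀) :
    ∃ C, 0 ≤ C ∧ ∀ (f : ι → Sm) (ε a b : ℝ), Neck f ε a b →
      ∀ (η η' : ℝ → ℝ) (hη : IsCutoff C₀ a b η η'),
      ∑ i, Iop hη.nice (Sm.gs (Sm.Th (f i))) ≤ C * (1 + ε / a ^ 2) := by
  obtain ⟨K, hK, hdec⟩ := exists_Iop_decay
  set n : ℝ := (Fintype.card ι : ℝ) with hn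
  have hn0 : 0 ≤ n := Nat.cast_nonneg _
  set M₁ : ℝ := 12 * (3 * Real.pi * C₀) with hM₁
  set M₂ : ℝ := 2 * C₀ * (6 + 4 * n) * 4 with hM₂
  set M₃ : ℝ := 4 * (11 + 16 * n) with hM₃
  have hpi := Real.pi_pos
  have hM₁0 : 0 ≤ M₁ := by positivity
  have hM₂0 : 0 ≤ M₂ := by positivity
  have hM₃0 : 0 ≤ M₃ := by positivity
  refine ⟨2 * (n * (2 * M₁ + (2 * (M₂ * K) + M₃ * K))), by positivity,
    fun f ε a b N η η' hη => ?_⟩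
  have ha := N.a_pos
  have hb := N.b_pos
  have hε := N.eps_pos
  have hbase : ∑ i, Iop hη.nice (Sm.L (f i) * Sm.Th (Sm.Th (f i)))
      = Iop hη.nice ((∑ k, Sm.Th (f k) * Sm.Th (f k)) * ∑ i, Sm.gs (f i))
        + ε * ∑ i, Iop hη.nice (angTest f i * Sm.L (Sm.L (f i))) := by
    rw [← map_sum, ← map_sum, ← smul_eq_mul ε, ← map_smul, ← map_add]
    refine Iop_congr _ fun x hx => ?_
    have hx' := N.mem_ball (hη.bounds hb hx).2
    simpa [Sm.gs, pow_two] using N.sum_angTest hx'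
  have hsmall : Iop hη.nice ((∑ k, Sm.Th (f k) * Sm.Th (f k)) * ∑ i, Sm.gs (f i))
      ≤ (1 / 40) * ∑ i, Iop (hη.nice_wt ha) (Sm.Th (f i) * Sm.Th (f i)) := by
    rw [← map_sum, ← smul_eq_mul (1 / 40 : ℝ), ← map_smul]
    refine Iop_mono _ _ fun x => ?_
    by_cases hx : η (‖x‖ ^ 2) = 0
    · rw [hx, zero_mul]
      refine mul_nonneg (hη.wt_nonneg ha _) ?_
      simp only [Sm.val_smul, Sm.val_sum, Sm.val_mul]
      exact mul_nonneg (by norm_num) (Finset.sum_nonneg fun i _ => mul_self_nonneg _)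
    · obtain ⟨h1, h2⟩ := hη.bounds hb hx
      have h3 := N.small x h1 h2
      rw [← hη.wt_mul ha (‖x‖ ^ 2)]
      have hw := hη.wt_nonneg ha (‖x‖ ^ 2)
      set w := wt a η (‖x‖ ^ 2)
      simp only [Sm.val_smul, Sm.val_sum, Sm.val_mul, Sm.gs, Sm.val_add]
      simp only [pow_two] at h3
      have hS : 0 ≤ ∑ i, (Sm.Th (f i)).1 x * (Sm.Th (f i)).1 x :=
        Finset.sum_nonneg fun i _ => mul_self_nonneg _
      set S := ∑ i, (Sm.Th (f i)).1 x * (Sm.Th (f i)).1 x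
      set P := ∑ i, ((Sm.D 0 (f i)).1 x * (Sm.D 0 (f i)).1 x
        + (Sm.D 1 (f i)).1 x * (Sm.D 1 (f i)).1 x)
      have := mul_le_mul_of_nonneg_left h3 (mul_nonneg hw hS)
      nlinarith
  have hpoin : ∑ i, Iop (hη.nice_wt ha) (Sm.Th (f i) * Sm.Th (f i))
      ≤ 20 * ∑ i, Iop hη.nice (Sm.gs (Sm.Th (f i))) := by
    rw [Finset.mul_sum]
    exact Finset.sum_le_sum fun i _ => hη.Iop_poincare_Th ha (f i)
  have hbdry : ∀ i, |Iop hη.nice_deriv (Sm.Th (f i) * Sm.euler (Sm.Th (f i)))| ≤ M₁ := by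
    intro i
    refine hη.abs_Iop_deriv_le hC₀ ha hb (by norm_num) fun x hx => ?_
    obtain ⟨h1, h2⟩ := hη.bounds_deriv hb hx
    have d := N.bd x h1 h2 i
    exact ((d.th.mul d.ne d.eu_th).mono (by norm_num : (2 : ℝ) * 6 ≤ 12)).abs_le
  have hterm : ∀ i, Iop hη.nice (angTest f i * Sm.L (Sm.L (f i)))
      ≤ (2 * (M₂ * K) + M₃ * K) / a ^ 2 := by
    intro i
    rw [hη.Iop_mul_L]
    have e1 := hdec η' hη.nice_deriv a ha hη.deriv_left M₂ hM₂0
      (angTest f i * Sm.euler (Sm.L (f i))) fun x hx hx0 => by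
        have h2 := (hη.bounds_deriv hb hx0).2
        have d := N.bd x hx h2 i
        have t1 := ((N.hb_angTest hx h2 i).mul d.ne d.eu_lap).abs_mul_pow_le d.ne 2
        have t2 := hη.abs_deriv_mul_sq_le hC₀ ha hb x
        calc _ = (|η' (‖x‖ ^ 2)| * ‖x‖ ^ 2)
              * (|(angTest f i * Sm.euler (Sm.L (f i))).1 x| * ‖x‖ ^ 2) := by ring
          _ ≤ 2 * C₀ * ((6 + 4 * n) * 4) := by gcongr
          _ = M₂ := by rw [hM₂]; ring
    have e2 := hdec η hη.nice a ha hη.zero_left M₃ hM₃0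
      (Sm.D 0 (angTest f i) * Sm.D 0 (Sm.L (f i)) + Sm.D 1 (angTest f i) * Sm.D 1 (Sm.L (f i)))
      fun x hx hx0 => by
        have h2 := (hη.bounds hb hx0).2
        have d := N.bd x hx h2 i
        have t1 := (((N.hb_D_angTest hx h2 i 0).mul d.ne (d.d_lap 0)).add
          ((N.hb_D_angTest hx h2 i 1).mul d.ne (d.d_lap 1))).abs_mul_pow_le d.ne 4
        rw [abs_of_nonneg (hη.nonneg _), mul_assoc]
        calc _ ≤ 1 * ((11 + 16 * n) * 2 + (11 + 16 * n) * 2) :=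
              mul_le_mul (hη.le_one _) t1 (by positivity) (by norm_num)
          _ = M₃ := by rw [hM₃]; ring
    have e1' := (abs_le.1 e1).1
    have e2' := (abs_le.1 e2).1
    rw [add_div, mul_div_assoc]
    linarith
  have hsum1 : ∑ i, Iop hη.nice (angTest f i * Sm.L (Sm.L (f i)))
      ≤ n * ((2 * (M₂ * K) + M₃ * K) / a ^ 2) := by
    calc _ ≤ ∑ _i : ι, (2 * (M₂ * K) + M₃ * K) / a ^ 2 := Finset.sum_le_sum fun i _ => hterm i
      _ = _ := by simp [hn]
  have hsum2 : -∑ i, Iop hη.nice_deriv (Sm.Th (f i) * Sm.euler (Sm.Th (f i))) ≤ n * M₁ := by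
    rw [← Finset.sum_neg_distrib]
    calc _ ≤ ∑ _i : ι, M₁ := Finset.sum_le_sum fun i _ => by linarith [(abs_le.1 (hbdry i)).1]
      _ = _ := by simp [hn]
  simp only [hη.Iop_L_mul_Th_Th, Finset.sum_add_distrib, ← Finset.mul_sum] at hbase
  have hε1 := mul_le_mul_of_nonneg_left hsum1 hε.le
  have hfin : 2 * (n * (2 * M₁ + (2 * (M₂ * K) + M₃ * K))) * (1 + ε / a ^ 2)
      = 2 * (2 * (n * M₁)) + 2 * (ε * (n * ((2 * (M₂ * K) + M₃ * K) / a ^ 2)))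
        + (2 * (2 * (n * M₁)) * (ε / a ^ 2) + 2 * n * (2 * (M₂ * K) + M₃ * K)) := by ring
  have hpos : 0 ≤ 2 * (2 * (n * M₁)) * (ε / a ^ 2) + 2 * n * (2 * (M₂ * K) + M₃ * K) := by
    positivity
  rw [hfin]
  linarith

/-- The primitive of `k` vanishing at `b²`. -/
def prim (b : ℝ) (k : ℝ → ℝ) (τ : ℝ) : ℝ := ∫ s in (b ^ 2)..τ, k s

lemma hasDerivAt_prim {k : ℝ → ℝ} (hk : Continuous k) (b τ : ℝ) : HasDerivAt (prim b k) (k τ) τ :=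
  (hk.integral_hasStrictDerivAt _ τ).hasDerivAt

lemma prim_eq_zero {k : ℝ → ℝ} {b : ℝ} (h : ∀ τ, b ^ 2 ≤ τ → k τ = 0) {τ : ℝ} (hτ : b ^ 2 ≤ τ) :
    prim b k τ = 0 := by
  rw [prim, intervalIntegral.integral_congr (g := fun _ => 0), intervalIntegral.integral_zero]
  intro s hs
  rw [Set.uIcc_of_le hτ] at hs
  exact h s hs.1

lemma nice_prim {k : ℝ → ℝ} (hk : Continuous k) {b : ℝ} (h : ∀ τ, b ^ 2 ≤ τ → k τ = 0) :
    Nice (prim b k) :=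
  ⟨continuous_iff_continuousAt.2 fun τ => (hasDerivAt_prim hk b τ).continuousAt, b ^ 2,
    fun _ hτ => prim_eq_zero h hτ⟩

/-- The radial component of the conserved rotation current. -/
def cur (f g : Sm) : Sm := f * Sm.euler g - g * Sm.euler f

/-- The fourth-order correction to the radial component of the conserved rotation current. -/
def curErr (f g : Sm) : Sm :=
  f * Sm.euler (Sm.L g) - g * Sm.euler (Sm.L f) - Sm.euler f * Sm.L g + Sm.euler g * Sm.L f

lemma sum_sq_sub {ι : Type*} [Fintype ι] (v w : ι → ℝ) :
    ∑ i, ∑ k, (v i * w k - v k * w i) ^ 2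
      = 2 * ((∑ i, v i ^ 2) * ∑ i, w i ^ 2) - 2 * (∑ i, v i * w i) ^ 2 := by
  have e : ∀ i k, (v i * w k - v k * w i) ^ 2
      = v i ^ 2 * w k ^ 2 + w i ^ 2 * v k ^ 2 - 2 * ((v i * w i) * (v k * w k)) := by
    intros; ring
  simp only [e, Finset.sum_sub_distrib, Finset.sum_add_distrib, ← Finset.mul_sum, ← Finset.sum_mul]
  ring

namespace Neck

variable {ι : Type*} [Fintype ι] {f : ι → Sm} {ε a b : ℝ} (N : Neck f ε a b)
include N

lemma Iop_cur {k : ℝ → ℝ} (hk : Nice k) (hb0 : ∀ τ, b ^ 2 ≤ τ → k τ = 0) (i j : ι) :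
    Iop hk (cur (f i) (f j)) = ε * Iop hk (curErr (f i) (f j)) := by
  have h1 := Iop_divergence (hasDerivAt_prim hk.1 b) (nice_prim hk.1 hb0) hk
    (f i * Sm.D 0 (f j) - f j * Sm.D 0 (f i)
        - ε • (f i * Sm.D 0 (Sm.L (f j)) - f j * Sm.D 0 (Sm.L (f i)) - Sm.D 0 (f i) * Sm.L (f j)
          + Sm.D 0 (f j) * Sm.L (f i)))
    (f i * Sm.D 1 (f j) - f j * Sm.D 1 (f i)
        - ε • (f i * Sm.D 1 (Sm.L (f j)) - f j * Sm.D 1 (Sm.L (f i)) - Sm.D 1 (f i) * Sm.L (f j)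
          + Sm.D 1 (f j) * Sm.L (f i)))
  rw [Sm.div_current, Iop_congr (H := 0) (nice_prim hk.1 hb0)] at h1
  · rw [map_zero, mul_zero] at h1
    rw [← smul_eq_mul ε, ← map_smul, ← sub_eq_zero, ← map_sub, ← h1]
    congr 1
    ext x
    simp [cur, curErr, Sm.euler]
    ring
  · intro x hx
    have hx' : ‖x‖ ≤ b := by
      by_contra hc
      have hb := N.b_pos
      exact hx (prim_eq_zero hb0 (by have := (not_le.1 hc).le; gcongr))
    obtain ⟨c, hc⟩ := N.eqn x (N.mem_ball hx')
    rw [Sm.val_sub, Sm.val_mul, Sm.val_mul, hc, hc, Sm.val_zero]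
    ring

lemma hb_cur {x : E2} (h : a ≤ ‖x‖) (h' : ‖x‖ ≤ b) (i j : ι) : HB x 0 4 (cur (f i) (f j)) := by
  have d := N.bd x h h'
  have hx := (d i).ne
  exact (((N.hb_self h' i).mul hx (d j).eu).sub ((N.hb_self h' j).mul hx (d i).eu)).mono
    (by norm_num)

lemma hb_curErr {x : E2} (h : a ≤ ‖x‖) (h' : ‖x‖ ≤ b) (i j : ι) :
    HB x (-2) 16 (curErr (f i) (f j)) := by
  have d := N.bd x h h'
  have hx := (d i).ne
  have h1 : HB x (-2) (1 * 4) (f i * Sm.euler (Sm.L (f j))) := (N.hb_self h' i).mul hx (d j).eu_lap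
  have h2 : HB x (-2) (1 * 4) (f j * Sm.euler (Sm.L (f i))) := (N.hb_self h' j).mul hx (d i).eu_lap
  have h3 : HB x (-2) (2 * 2) (Sm.euler (f i) * Sm.L (f j)) := (d i).eu.mul hx (d j).lap
  have h4 : HB x (-2) (2 * 2) (Sm.euler (f j) * Sm.L (f i)) := (d j).eu.mul hx (d i).lap
  exact (((h1.sub h2).sub h3).add h4).mono (by norm_num)

lemma sum_cur_sq {x : E2} (hx : x ∈ ball (0 : E2) (1 / 2)) :
    ∑ i, ∑ j, (cur (f i) (f j)).1 x ^ 2 = 2 * ∑ i, (Sm.euler (f i)).1 x ^ 2 := by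
  have := sum_sq_sub (fun i => (f i).1 x) (fun i => (Sm.euler (f i)).1 x)
  rw [N.sum_mul_Eu x hx, N.sphere x hx] at this
  simpa [cur] using this

lemma Th_cur_sq_le {x : E2} (h : a ≤ ‖x‖) (h' : ‖x‖ ≤ b) (i j : ι) :
    (Sm.Th (cur (f i) (f j))).1 x ^ 2 ≤ 16 * ((Sm.Th (f i)).1 x ^ 2 + (Sm.Th (f j)).1 x ^ 2)
      + 4 * ((Sm.euler (Sm.Th (f i))).1 x ^ 2 + (Sm.euler (Sm.Th (f j))).1 x ^ 2) := by
  have d := N.bd x h h'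
  have e : (Sm.Th (cur (f i) (f j))).1 x
      = (Sm.Th (f i)).1 x * (Sm.euler (f j)).1 x + (f i).1 x * (Sm.euler (Sm.Th (f j))).1 x
        - (Sm.Th (f j)).1 x * (Sm.euler (f i)).1 x - (f j).1 x * (Sm.euler (Sm.Th (f i))).1 x := by
    rw [cur, Sm.Th_sub, Sm.Th_mul, Sm.Th_mul, Sm.Th_Eu_comm, Sm.Th_Eu_comm]
    simp
    ring
  have sq : ∀ {p q M : ℝ}, |q| ≤ M → (p * q) ^ 2 ≤ M ^ 2 * p ^ 2 := by
    intro p q M hq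
    rw [mul_pow, mul_comm]
    have : q ^ 2 ≤ M ^ 2 := sq_le_sq' (abs_le.1 hq).1 (abs_le.1 hq).2
    gcongr
  have h1 := sq (p := (Sm.Th (f i)).1 x) (d j).eu.abs_le
  have h2 := sq (p := (Sm.euler (Sm.Th (f j))).1 x) (N.hb_self h' i).abs_le
  have h3 := sq (p := (Sm.Th (f j)).1 x) (d i).eu.abs_le
  have h4 := sq (p := (Sm.euler (Sm.Th (f i))).1 x) (N.hb_self h' j).abs_le
  rw [e]
  rw [mul_comm] at h2 h4
  generalize (Sm.Th (f i)).1 x * (Sm.euler (f j)).1 x = p at *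
  generalize (f i).1 x * (Sm.euler (Sm.Th (f j))).1 x = q at *
  generalize (Sm.Th (f j)).1 x * (Sm.euler (f i)).1 x = r at *
  generalize (f j).1 x * (Sm.euler (Sm.Th (f i))).1 x = s at *
  nlinarith [sq_nonneg (p - q), sq_nonneg (p + r), sq_nonneg (p + s), sq_nonneg (q + r),
    sq_nonneg (q + s), sq_nonneg (r - s)]

end Neck

lemma nice_mul_circleMean {k : ℝ → ℝ} (hk : Nice k) (g : Sm) :
    Nice fun τ => k τ * circleMean g.1 (Real.sqrt τ) := by
  obtain ⟨hc, β, hβ⟩ := hk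
  have := continuous_circleMean g.continuous
  exact ⟨by fun_prop, β, fun τ h => by simp only [hβ τ h, zero_mul]⟩

/-- The radial energy on the neck is bounded. -/
lemma exists_radial_bound (ι : Type*) [Fintype ι] {C₀ : ℝ} (hC₀ : 0 ≤ C₀) :
    ∃ C, 0 ≤ C ∧ ∀ (f : ι → Sm) (ε a b : ℝ) (N : Neck f ε a b)
      (η η' : ℝ → ℝ) (hη : IsCutoff C₀ a b η η'),
      ∑ i, Iop (hη.nice_wt N.a_pos) (Sm.euler (f i) * Sm.euler (f i)) ≤ C * (1 + ε / a ^ 2) := by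
  obtain ⟨K, hK, hdec⟩ := exists_Iop_decay
  obtain ⟨C, hC, hang⟩ := exists_angular_bound ι hC₀
  set n : ℝ := (Fintype.card ι : ℝ) with hn
  have hn0 : 0 ≤ n := Nat.cast_nonneg _
  refine ⟨n ^ 2 * (64 * K) + 20 * 324 * (2 * n * C), by positivity, fun f ε a b N η η' hη => ?_⟩
  have ha := N.a_pos
  have hb := N.b_pos
  have hε := N.eps_pos
  set J := Iop (hη.nice_wt ha) with hJ
  set A := fun i => Iop hη.nice (Sm.gs (Sm.Th (f i))) with hA
  have hmean : ∀ i j, (∫ x, wt a η (‖x‖ ^ 2) * (circleMean (cur (f i) (f j)).1 ‖x‖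
      * (cur (f i) (f j)).1 x)) ≤ 64 * K * (ε / a ^ 2) := by
    intro i j
    have hk := nice_mul_circleMean (hη.nice_wt ha) (cur (f i) (f j))
    have e : (∫ x, wt a η (‖x‖ ^ 2) * (circleMean (cur (f i) (f j)).1 ‖x‖
        * (cur (f i) (f j)).1 x)) = Iop hk (cur (f i) (f j)) := by
      rw [Iop_apply]
      congr 1; ext x
      rw [Real.sqrt_sq (norm_nonneg _)]; ring
    rw [e, N.Iop_cur hk fun τ h => by simp only [hη.wt_zero_right h, zero_mul]]
    have h1 := hdec _ hk a ha (fun τ h => by simp only [hη.wt_zero_left h, zero_mul]) 64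
      (by norm_num) (curErr (f i) (f j)) fun x hx hx0 => by
        obtain ⟨-, h2⟩ := hη.bounds_wt hb (left_ne_zero_of_mul hx0)
        have d := N.bd x hx h2 i
        have t1 := (N.hb_curErr hx h2 i j).abs_mul_pow_le d.ne 2
        have t2 : |circleMean (cur (f i) (f j)).1 ‖x‖| ≤ 4 := abs_circleMean_le fun θ => by
          have := norm_cpt (norm_nonneg x) θ
          exact (N.hb_cur (hx.trans this.ge) (this.trans_le h2) i j).abs_le
        have t3 := hη.wt_mul_le ha (‖x‖ ^ 2)
        have t4 := hη.wt_nonneg ha (‖x‖ ^ 2)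
        rw [Real.sqrt_sq (norm_nonneg _), abs_mul, abs_of_nonneg t4]
        calc _ = (wt a η (‖x‖ ^ 2) * ‖x‖ ^ 2) * (|circleMean (cur (f i) (f j)).1 ‖x‖|
              * (|(curErr (f i) (f j)).1 x| * ‖x‖ ^ 2)) := by ring
          _ ≤ 1 * (4 * 16) := by gcongr
          _ = 64 := by norm_num
    calc _ ≤ ε * (64 * K / a ^ 2) := by
          gcongr; exact (abs_le.1 h1).2
      _ = _ := by ring
  have hTh : ∀ i j, J (Sm.Th (cur (f i) (f j)) * Sm.Th (cur (f i) (f j)))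
      ≤ 324 * (A i + A j) := by
    intro i j
    have h1 : J (Sm.Th (cur (f i) (f j)) * Sm.Th (cur (f i) (f j)))
        ≤ J ((16 : ℝ) • (Sm.Th (f i) * Sm.Th (f i) + Sm.Th (f j) * Sm.Th (f j))
          + (4 : ℝ) • (Sm.euler (Sm.Th (f i)) * Sm.euler (Sm.Th (f i))
            + Sm.euler (Sm.Th (f j)) * Sm.euler (Sm.Th (f j)))) := by
      refine Iop_mono _ _ fun x => ?_
      by_cases hx : wt a η (‖x‖ ^ 2) = 0
      · rw [hx, zero_mul, zero_mul]
      · obtain ⟨h1, h2⟩ := hη.bounds_wt hb hx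
        refine mul_le_mul_of_nonneg_left ?_ (hη.wt_nonneg ha _)
        have h3 := N.Th_cur_sq_le h1 h2 i j
        simp [pow_two] at h3 ⊢
        linarith
    simp only [map_add, map_smul, smul_eq_mul] at h1
    have q1 := hη.Iop_poincare_Th ha (f i)
    have q2 := hη.Iop_poincare_Th ha (f j)
    have q3 := (hη.Iop_wt_sq_le ha (Sm.Th (f i))).2
    have q4 := (hη.Iop_wt_sq_le ha (Sm.Th (f j))).2
    simp only [hA]
    linarith
  have hcur : ∀ i j, J (cur (f i) (f j) * cur (f i) (f j))
      ≤ 64 * K * (ε / a ^ 2) + 20 * (324 * (A i + A j)) := by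
    intro i j
    have h1 := radial_poincare (hη.nice_wt ha).1 (hη.wt_nonneg ha) (β := b ^ 2)
      (fun τ h => hη.wt_zero_right h) (cur (f i) (f j))
    have e : ∀ g : Sm, J (g * g) = ∫ x, wt a η (‖x‖ ^ 2) * g.1 x ^ 2 := by
      intro g
      simp [hJ, Iop_apply, pow_two]
    rw [← e, ← e] at h1
    have h2 : 0 ≤ J (Sm.Th (cur (f i) (f j)) * Sm.Th (cur (f i) (f j))) :=
      Iop_nonneg _ (hη.wt_nonneg ha) fun x => mul_self_nonneg _
    have hpi : Real.pi ^ 2 ≤ 10 := by nlinarith [Real.pi_lt_d2, Real.pi_pos]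
    have h3 := hTh i j
    have h4 := hmean i j
    nlinarith
  have hsum : 2 * ∑ i, J (Sm.euler (f i) * Sm.euler (f i))
      = ∑ i, ∑ j, J (cur (f i) (f j) * cur (f i) (f j)) := by
    simp only [← map_sum]
    rw [← smul_eq_mul (2 : ℝ), ← map_smul]
    refine (Iop_congr _ fun x hx => ?_).symm
    have hx' := N.mem_ball (hη.bounds_wt hb hx).2
    simpa [pow_two] using N.sum_cur_sq hx'
  have hbound : ∑ i, ∑ j, J (cur (f i) (f j) * cur (f i) (f j))
      ≤ n ^ 2 * (64 * K) * (ε / a ^ 2) + 20 * 324 * (2 * n * ∑ i, A i) := by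
    calc _ ≤ ∑ i, ∑ j, (64 * K * (ε / a ^ 2) + 20 * (324 * (A i + A j))) :=
          Finset.sum_le_sum fun i _ => Finset.sum_le_sum fun j _ => hcur i j
      _ = _ := by
          simp [Finset.sum_add_distrib, ← Finset.mul_sum]
          ring
  have hAb : ∑ i, A i ≤ C * (1 + ε / a ^ 2) := hang f ε a b N η η' hη
  have hea : 0 ≤ ε / a ^ 2 := by positivity
  have h5 : 2 * n * ∑ i, A i ≤ 2 * n * (C * (1 + ε / a ^ 2)) := by gcongr
  have h6 : 0 ≤ n ^ 2 * (64 * K) := by positivity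
  have h7 : 0 ≤ ∑ i, J (Sm.euler (f i) * Sm.euler (f i)) := Finset.sum_nonneg fun i _ =>
    Iop_nonneg _ (hη.wt_nonneg ha) fun x => mul_self_nonneg _
  nlinarith

/-- The fourth-order part of the radial component of the stress-energy field. -/
def strErr (f : Sm) : Sm :=
  (Sm.X 0 * Sm.X 0 + Sm.X 1 * Sm.X 1) * ((1 / 2 : ℝ) • (Sm.L f * Sm.L f)
    + (Sm.D 0 f * Sm.D 0 (Sm.L f) + Sm.D 1 f * Sm.D 1 (Sm.L f)))
    - (2 : ℝ) • (Sm.euler f * Sm.euler (Sm.L f))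

lemma DerivBd.hb_strErr {x : E2} {f : Sm} (d : DerivBd x f) : HB x (-2) 32 (strErr f) := by
  have hx := d.ne
  have h0 : HB x 2 (1 * 1 + 1 * 1) (Sm.X 0 * Sm.X 0 + Sm.X 1 * Sm.X 1) :=
    ((HB.X 0).mul hx (HB.X 0)).add ((HB.X 1).mul hx (HB.X 1))
  have h1 : HB x (-4) (2 * 2) ((1 / 2 : ℝ) • (Sm.L f * Sm.L f)) := by
    have := d.lap.mul hx d.lap
    refine le_trans ?_ this
    rw [Sm.val_smul, abs_mul]
    norm_num
    linarith [mul_self_nonneg ((Sm.L f).1 x)]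
  have h2 : HB x (-4) (1 * 2 + 1 * 2)
      (Sm.D 0 f * Sm.D 0 (Sm.L f) + Sm.D 1 f * Sm.D 1 (Sm.L f)) :=
    ((d.one 0).mul hx (d.d_lap 0)).add ((d.one 1).mul hx (d.d_lap 1))
  have h3 : HB x (-2) (2 * 4) (Sm.euler f * Sm.euler (Sm.L f)) := d.eu.mul hx d.eu_lap
  have e : (2 : ℝ) • (Sm.euler f * Sm.euler (Sm.L f))
      = Sm.euler f * Sm.euler (Sm.L f) + Sm.euler f * Sm.euler (Sm.L f) := two_smul _ _
  rw [strErr, e]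
  have h4 : HB x (-2) _ _ := h0.mul hx (h1.add h2)
  exact (h4.sub (h3.add h3)).mono (by norm_num)

namespace Neck

variable {ι : Type*} [Fintype ι] {f : ι → Sm} {ε a b : ℝ} (N : Neck f ε a b)
include N

lemma pohozaev {k : ℝ → ℝ} (hk : Nice k) (hb0 : ∀ τ, b ^ 2 ≤ τ → k τ = 0) :
    -(ε * ∑ i, Iop (nice_prim hk.1 hb0) (Sm.L (f i) * Sm.L (f i)))
      = ∑ i, Iop hk (Sm.euler (f i) * Sm.euler (f i)) - ∑ i, Iop hk (Sm.Th (f i) * Sm.Th (f i))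
        + 2 * (ε * ∑ i, Iop hk (strErr (f i))) := by
  have h1 : ∀ i, Iop hk ((1 / 2 : ℝ) • (Sm.Th (f i) * Sm.Th (f i) - Sm.euler (f i) * Sm.euler (f i))
      - ε • strErr (f i))
      = (1 / 2) * (Iop (nice_prim hk.1 hb0)
          (Sm.euler (f i) * (Sm.L (f i) - ε • Sm.L (Sm.L (f i))))
        + ε * Iop (nice_prim hk.1 hb0) (Sm.L (f i) * Sm.L (f i))) := by
    intro i
    have := Iop_divergence (hasDerivAt_prim hk.1 b) (nice_prim hk.1 hb0) hk
      ((1 / 2 : ℝ) • (Sm.X 0 * Sm.gs (f i)) - Sm.euler (f i) * Sm.D 0 (f i)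
        - ε • ((1 / 2 : ℝ) • (Sm.X 0 * (Sm.L (f i) * Sm.L (f i)))
          + Sm.X 0 * (Sm.D 0 (f i) * Sm.D 0 (Sm.L (f i)) + Sm.D 1 (f i) * Sm.D 1 (Sm.L (f i)))
          - Sm.euler (f i) * Sm.D 0 (Sm.L (f i)) - Sm.D 0 (f i) * Sm.euler (Sm.L (f i))))
      ((1 / 2 : ℝ) • (Sm.X 1 * Sm.gs (f i)) - Sm.euler (f i) * Sm.D 1 (f i)
        - ε • ((1 / 2 : ℝ) • (Sm.X 1 * (Sm.L (f i) * Sm.L (f i)))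
          + Sm.X 1 * (Sm.D 0 (f i) * Sm.D 0 (Sm.L (f i)) + Sm.D 1 (f i) * Sm.D 1 (Sm.L (f i)))
          - Sm.euler (f i) * Sm.D 1 (Sm.L (f i)) - Sm.D 1 (f i) * Sm.euler (Sm.L (f i))))
    rw [Sm.gs, Sm.div_stress (f i) ε, map_sub, map_neg, map_smul, smul_eq_mul] at this
    convert this using 1
    · congr 1
      ext x
      simp [strErr, Sm.euler, Sm.Th]
      ring
    · ring
  have h2 : ∑ i, Iop (nice_prim hk.1 hb0)
      (Sm.euler (f i) * (Sm.L (f i) - ε • Sm.L (Sm.L (f i)))) = 0 := by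
    rw [← map_sum]
    refine (Iop_congr (H := 0) _ fun x hx => ?_).trans (map_zero _)
    have hx' : ‖x‖ ≤ b := by
      by_contra hc
      have hb := N.b_pos
      exact hx (prim_eq_zero hb0 (by have := (not_le.1 hc).le; gcongr))
    have hm := N.mem_ball hx'
    have := N.test hm (g := fun i => (Sm.euler (f i)).1 x) (by
      simpa [mul_comm] using N.sum_mul_Eu x hm)
    rw [Sm.val_sum]
    exact this
  have h3 := Finset.sum_congr (rfl : (Finset.univ : Finset ι) = Finset.univ) fun i _ => h1 i
  rw [← Finset.mul_sum, Finset.sum_add_distrib, h2, ← Finset.mul_sum] at h3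
  simp only [map_sub, map_smul, smul_eq_mul, Finset.sum_sub_distrib, ← Finset.mul_sum] at h3
  linarith

end Neck

namespace IsCutoff

variable {C a b : ℝ} {η η' : ℝ → ℝ} (hη : IsCutoff C a b η η') (ha : 0 < a) (hab : 2 * a ≤ b)
include hη ha

lemma prim_wt_nonpos (τ : ℝ) : prim b (wt a η) τ ≤ 0 := by
  rcases le_total (b ^ 2) τ with h | h
  · rw [prim_eq_zero (fun τ h => hη.wt_zero_right h) h]
  · rw [prim, intervalIntegral.integral_symm, neg_nonpos]
    exact intervalIntegral.integral_nonneg h fun s _ => hη.wt_nonneg ha s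

include hab in
lemma log_le_neg_prim_wt {τ : ℝ} (hτ : τ ≤ a ^ 2) :
    Real.log (b ^ 2 / (4 * a ^ 2)) ≤ -prim b (wt a η) τ := by
  have hb : 0 < b := by linarith
  have ha2 : 0 < a ^ 2 := by positivity
  have hab2 : 2 * a ^ 2 ≤ b ^ 2 / 2 := by nlinarith
  have hInt : ∀ p q, IntervalIntegrable (wt a η) volume p q :=
    fun p q => (hη.nice_wt ha).1.intervalIntegrable p q
  have h1 : ∫ s in (2 * a ^ 2)..(b ^ 2 / 2), wt a η s = Real.log (b ^ 2 / (4 * a ^ 2)) := by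
    have : ∫ s in (2 * a ^ 2)..(b ^ 2 / 2), wt a η s = ∫ s in (2 * a ^ 2)..(b ^ 2 / 2), 1 / s := by
      refine intervalIntegral.integral_congr fun s hs => ?_
      rw [Set.uIcc_of_le hab2] at hs
      simp only [wt]
      rw [hη.eq_one s hs.1 hs.2, max_eq_left (by linarith [hs.1])]
    rw [this, integral_one_div_of_pos (by positivity) (by positivity)]
    congr 1
    field_simp
    norm_num
  rw [← h1, prim, intervalIntegral.integral_symm τ, neg_neg]
  exact intervalIntegral.integral_mono_interval (by linarith) hab2 (by nlinarith)
    (Eventually.of_forall fun s => hη.wt_nonneg ha s) (hInt _ _)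

end IsCutoff

/-- The Laplacian energy inside the neck is controlled with a logarithmic gain. -/
lemma exists_log_bound (ι : Type*) [Fintype ι] :
    ∃ C, 0 ≤ C ∧ ∀ (f : ι → Sm) (ε a b : ℝ), Neck f ε a b →
      ∀ (y : E2) (ρ m : ℝ), 0 ≤ ρ → 0 ≤ m → ball y ρ ⊆ closedBall 0 a →
      (∀ x ∈ ball y ρ, m ≤ ∑ i, (Sm.L (f i)).1 x ^ 2) →
      ε * (Real.log (b ^ 2 / (4 * a ^ 2)) * m * (ρ ^ 2 * Real.pi)) ≤ C * (1 + ε / a ^ 2) := by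
  obtain ⟨K, hK, hdec⟩ := exists_Iop_decay
  obtain ⟨C₀, hC₀, hcut⟩ := exists_cutoff
  obtain ⟨C, hC, hrad⟩ := exists_radial_bound ι hC₀
  set n : ℝ := (Fintype.card ι : ℝ) with hn
  have hn0 : 0 ≤ n := Nat.cast_nonneg _
  refine ⟨C + 2 * (n * (32 * K)), by positivity, fun f ε a b N y ρ m hρ hm hsub hlow => ?_⟩
  have ha := N.a_pos
  have hb := N.b_pos
  have hε := N.eps_pos
  obtain ⟨η, η', hη⟩ := hcut a b ha N.two_a_le
  have hr := hrad f ε a b N η η' hη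
  have hk := hη.nice_wt ha
  have hb0 : ∀ τ, b ^ 2 ≤ τ → wt a η τ = 0 := fun τ h => hη.wt_zero_right h
  have hP := N.pohozaev hk hb0
  have hT : 0 ≤ ∑ i, Iop hk (Sm.Th (f i) * Sm.Th (f i)) := Finset.sum_nonneg fun i _ =>
    Iop_nonneg _ (hη.wt_nonneg ha) fun x => mul_self_nonneg _
  have hE : ∑ i, Iop hk (strErr (f i)) ≤ n * (32 * K / a ^ 2) := by
    calc _ ≤ ∑ _i : ι, 32 * K / a ^ 2 := by
          refine Finset.sum_le_sum fun i _ => (abs_le.1 (hdec _ hk a ha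
            (fun τ h => hη.wt_zero_left h) 32 (by norm_num) (strErr (f i)) fun x hx hx0 => ?_)).2
          have d := N.bd x hx (hη.bounds_wt hb hx0).2 i
          have t1 := d.hb_strErr.abs_mul_pow_le d.ne 2
          have t2 := hη.wt_mul_le ha (‖x‖ ^ 2)
          have t3 := hη.wt_nonneg ha (‖x‖ ^ 2)
          rw [abs_of_nonneg t3]
          calc _ = (wt a η (‖x‖ ^ 2) * ‖x‖ ^ 2) * (|(strErr (f i)).1 x| * ‖x‖ ^ 2) := by ring
            _ ≤ 1 * 32 := by gcongr
            _ = 32 := by norm_num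
      _ = _ := by simp [hn]
  have hlog : 0 ≤ Real.log (b ^ 2 / (4 * a ^ 2)) := by
    refine Real.log_nonneg ?_
    rw [le_div_iff₀ (by positivity)]
    nlinarith [N.two_a_le]
  have hlower : Real.log (b ^ 2 / (4 * a ^ 2)) * m * (ρ ^ 2 * Real.pi)
      ≤ -∑ i, Iop (nice_prim hk.1 hb0) (Sm.L (f i) * Sm.L (f i)) := by
    rw [← map_sum, Iop_apply, ← integral_neg]
    have hpos : ∀ x : E2, 0 ≤ -(prim b (wt a η) (‖x‖ ^ 2)
        * (∑ i, Sm.L (f i) * Sm.L (f i)).1 x) := by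
      intro x
      rw [← neg_mul]
      refine mul_nonneg (neg_nonneg.2 (hη.prim_wt_nonpos ha _)) ?_
      simp only [Sm.val_sum, Sm.val_mul]
      exact Finset.sum_nonneg fun i _ => mul_self_nonneg _
    have hi : Integrable fun x : E2 => -(prim b (wt a η) (‖x‖ ^ 2)
        * (∑ i, Sm.L (f i) * Sm.L (f i)).1 x) := ((nice_prim hk.1 hb0).integrable _).neg
    refine le_trans ?_ (setIntegral_le_integral (s := ball y ρ) hi (Eventually.of_forall hpos))
    have hc : ∫ _x in ball y ρ, Real.log (b ^ 2 / (4 * a ^ 2)) * m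
        = Real.log (b ^ 2 / (4 * a ^ 2)) * m * (ρ ^ 2 * Real.pi) := by
      rw [setIntegral_const, Measure.real, EuclideanSpace.volume_ball_fin_two]
      simp [ENNReal.toReal_ofReal hρ, Real.pi_pos.le]
      ring
    rw [← hc]
    refine setIntegral_mono_on (integrableOn_const (hs := measure_ball_lt_top.ne)) hi.integrableOn
      measurableSet_ball fun x hx => ?_
    have hx' : ‖x‖ ≤ a := mem_closedBall_zero_iff.1 (hsub hx)
    rw [← neg_mul]
    have := hlow x hx
    refine mul_le_mul (hη.log_le_neg_prim_wt ha N.two_a_le (by gcongr)) ?_ hm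
      (neg_nonneg.2 (hη.prim_wt_nonpos ha _))
    simpa [pow_two] using this
  have h1 := mul_le_mul_of_nonneg_left hlower hε.le
  have h2 := mul_le_mul_of_nonneg_left hE hε.le
  have h3 : (C + 2 * (n * (32 * K))) * (1 + ε / a ^ 2)
      = C * (1 + ε / a ^ 2) + 2 * (ε * (n * (32 * K / a ^ 2))) + 2 * (n * (32 * K)) := by ring
  have h4 : 0 ≤ 2 * (n * (32 * K)) := by positivity
  rw [h3]
  linarith

lemma exists_Sm_extension {l : ℕ} {u : E2 → Eu l} (hu : ContDiffOn ℝ (⊤ : ℕ∞) u (ball 0 1)) :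
    ∃ f : Fin l → Sm, ∀ i, ∀ x ∈ ball (0 : E2) (1 / 2), (f i).1 x = u x i := by
  let χ : ContDiffBump (0 : E2) := ⟨1 / 2, 3 / 4, by norm_num, by norm_num⟩
  have hsmooth : ∀ i, ContDiff ℝ (⊤ : ℕ∞) fun x => χ x * u x i := by
    intro i
    rw [contDiff_iff_contDiffAt]
    intro x
    by_cases hx : x ∈ ball (0 : E2) 1
    · have h1 : ContDiffAt ℝ (⊤ : ℕ∞) u x := hu.contDiffAt (isOpen_ball.mem_nhds hx)
      have h2 : ContDiffAt ℝ (⊤ : ℕ∞) (fun y => u y i) x :=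
        (EuclideanSpace.proj i : Eu l →L[ℝ] ℝ).contDiff.contDiffAt.comp x h1
      exact χ.contDiffAt.mul h2
    · have hx' : x ∉ tsupport χ := by
        rw [χ.tsupport_eq]
        intro h
        have h3 : dist x 0 ≤ 3 / 4 := h
        exact hx (lt_of_le_of_lt h3 (by norm_num))
      have h0 : (fun y => χ y * u y i) =ᶠ[nhds x] fun _ => 0 := by
        filter_upwards [notMem_tsupport_iff_eventuallyEq.1 hx'] with y hy
        rw [hy]; simp
      exact contDiffAt_const.congr_of_eventuallyEq h0
  refine ⟨fun i => ⟨_, hsmooth i⟩, fun i x hx => ?_⟩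
  have : χ x = 1 := χ.one_of_mem_closedBall (ball_subset_closedBall hx)
  change χ x * u x i = u x i
  rw [this, one_mul]

section

variable {l : ℕ} {U : Set E2}

lemma contDiffOn_pd (hU : IsOpen U) {v : E2 → Eu l} (hv : ContDiffOn ℝ (⊤ : ℕ∞) v U) (α : Fin 2) :
    ContDiffOn ℝ (⊤ : ℕ∞) (pd α v) U := by
  unfold pd
  exact (hv.fderiv_of_isOpen hU (m := (⊤ : ℕ∞)) (by simp)).clm_apply contDiffOn_const

lemma contDiffOn_lap (hU : IsOpen U) {v : E2 → Eu l} (hv : ContDiffOn ℝ (⊤ : ℕ∞) v U) :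
    ContDiffOn ℝ (⊤ : ℕ∞) (lap v) U :=
  (contDiffOn_pd hU (contDiffOn_pd hU hv 0) 0).add (contDiffOn_pd hU (contDiffOn_pd hU hv 1) 1)

lemma Sm.D_eq_pd (hU : IsOpen U) {v : E2 → Eu l} (hv : ContDiffOn ℝ (⊤ : ℕ∞) v U) {i : Fin l}
    {g : Sm} (hg : ∀ x ∈ U, g.1 x = v x i) (α : Fin 2) :
    ∀ x ∈ U, (Sm.D α g).1 x = pd α v x i := by
  intro x hx
  have h1 : g.1 =ᶠ[nhds x] fun y => (EuclideanSpace.proj i : Eu l →L[ℝ] ℝ) (v y) := by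
    filter_upwards [hU.mem_nhds hx] with y hy using hg y hy
  have h2 : DifferentiableAt ℝ v x := (hv.contDiffAt (hU.mem_nhds hx)).differentiableAt (by simp)
  rw [Sm.D_val, pds, h1.fderiv_eq]
  have h3 := ((EuclideanSpace.proj i : Eu l →L[ℝ] ℝ).hasFDerivAt.comp x h2.hasFDerivAt).fderiv
  rw [Function.comp_def] at h3
  rw [h3]
  rfl

lemma Sm.L_eq_lap (hU : IsOpen U) {v : E2 → Eu l} (hv : ContDiffOn ℝ (⊤ : ℕ∞) v U) {i : Fin l}
    {g : Sm} (hg : ∀ x ∈ U, g.1 x = v x i) : ∀ x ∈ U, (Sm.L g).1 x = lap v x i := by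
  intro x hx
  have h := fun α => Sm.D_eq_pd hU (contDiffOn_pd hU hv α) (Sm.D_eq_pd hU hv hg α) α x hx
  simp only [Sm.L, Sm.val_add, h, lap, PiLp.add_apply]

lemma norm_iteratedFDeriv_pd_le (hU : IsOpen U) {v : E2 → Eu l}
    (hv : ContDiffOn ℝ (⊤ : ℕ∞) v U) (α : Fin 2) (n : ℕ) {x : E2} (hx : x ∈ U) :
    ‖iteratedFDeriv ℝ n (pd α v) x‖ ≤ ‖iteratedFDeriv ℝ (n + 1) v x‖ := by
  have h1 : ContDiffAt ℝ (⊤ : ℕ∞) (fderiv ℝ v) x :=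
    (hv.fderiv_of_isOpen hU (m := (⊤ : ℕ∞)) (by simp)).contDiffAt (hU.mem_nhds hx)
  have h2 := norm_iteratedFDeriv_clm_apply_const (c := (EuclideanSpace.single α 1 : E2))
    (n := n) h1 (by exact_mod_cast le_top)
  rw [norm_iteratedFDeriv_fderiv, PiLp.norm_single, norm_one, one_mul] at h2
  exact h2

lemma norm_pd_le (hU : IsOpen U) {v : E2 → Eu l}
    (hv : ContDiffOn ℝ (⊤ : ℕ∞) v U) (α : Fin 2) {x : E2} (hx : x ∈ U) :
    ‖pd α v x‖ ≤ ‖iteratedFDeriv ℝ 1 v x‖ := by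
  simpa using norm_iteratedFDeriv_pd_le hU hv α 0 hx

lemma norm_pd_pd_le (hU : IsOpen U) {v : E2 → Eu l}
    (hv : ContDiffOn ℝ (⊤ : ℕ∞) v U) (α β : Fin 2) {x : E2} (hx : x ∈ U) :
    ‖pd α (pd β v) x‖ ≤ ‖iteratedFDeriv ℝ 2 v x‖ :=
  (norm_pd_le hU (contDiffOn_pd hU hv β) α hx).trans (norm_iteratedFDeriv_pd_le hU hv β 1 hx)

lemma norm_pd_pd_pd_le (hU : IsOpen U) {v : E2 → Eu l}
    (hv : ContDiffOn ℝ (⊤ : ℕ∞) v U) (α β γ : Fin 2) {x : E2} (hx : x ∈ U) :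
    ‖pd α (pd β (pd γ v)) x‖ ≤ ‖iteratedFDeriv ℝ 3 v x‖ :=
  (norm_pd_pd_le hU (contDiffOn_pd hU hv γ) α β hx).trans (norm_iteratedFDeriv_pd_le hU hv γ 2 hx)

lemma lap_eq_iteratedFDeriv (hU : IsOpen U) {v : E2 → Eu l}
    (hv : ContDiffOn ℝ (⊤ : ℕ∞) v U) {x : E2} (hx : x ∈ U) :
    lap v x = iteratedFDeriv ℝ 2 v x (fun _ => EuclideanSpace.single 0 1)
      + iteratedFDeriv ℝ 2 v x (fun _ => EuclideanSpace.single 1 1) := by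
  have h1 : DifferentiableAt ℝ (fderiv ℝ v) x :=
    ((hv.fderiv_of_isOpen hU (m := (⊤ : ℕ∞)) (by simp)).contDiffAt
      (hU.mem_nhds hx)).differentiableAt (by simp)
  have key : ∀ α, pd α (pd α v) x
      = iteratedFDeriv ℝ 2 v x (fun _ => EuclideanSpace.single α 1) := by
    intro α
    rw [iteratedFDeriv_two_apply]
    change fderiv ℝ (fun y => fderiv ℝ v y (EuclideanSpace.single α 1)) x _ = _
    rw [fderiv_clm_apply h1 (differentiableAt_const _)]
    simp
  rw [lap, key, key]

lemma norm_lap_sub_le (hU : IsOpen U) {v w : E2 → Eu l} (hv : ContDiffOn ℝ (⊤ : ℕ∞) v U)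
    (hw : ContDiffOn ℝ (⊤ : ℕ∞) w U) {x : E2} (hx : x ∈ U) :
    ‖lap v x - lap w x‖ ≤ 2 * ‖iteratedFDeriv ℝ 2 v x - iteratedFDeriv ℝ 2 w x‖ := by
  have key : ∀ α : Fin 2, ‖(iteratedFDeriv ℝ 2 v x - iteratedFDeriv ℝ 2 w x)
      (fun _ => EuclideanSpace.single α 1)‖
        ≤ ‖iteratedFDeriv ℝ 2 v x - iteratedFDeriv ℝ 2 w x‖ := by
    intro α
    have := (iteratedFDeriv ℝ 2 v x - iteratedFDeriv ℝ 2 w x).le_opNorm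
      (fun _ => (EuclideanSpace.single α 1 : E2))
    simpa using this
  rw [lap_eq_iteratedFDeriv hU hv hx, lap_eq_iteratedFDeriv hU hw hx, add_sub_add_comm, two_mul]
  exact (norm_add_le _ _).trans (add_le_add (key 0) (key 1))

lemma lap_comp_smul (u : E2 → Eu l) (r : ℝ) (y : E2) :
    lap (fun z => u (r • z)) y = r ^ 2 • lap u (r • y) := by
  have key : ∀ (α : Fin 2) (v : E2 → Eu l),
      pd α (fun z => v (r • z)) = fun z => r • pd α v (r • z) := by
    intro α v
    ext1 z
    unfold pd
    rw [fderiv_comp_smul]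
    rfl
  have key2 : ∀ (α : Fin 2) (v : E2 → Eu l) (z : E2), pd α (fun z => r • v z) z = r • pd α v z := by
    intro α v z
    unfold pd
    change fderiv ℝ (r • v) z _ = _
    rw [fderiv_const_smul_field]
    rfl
  simp only [lap, key, key2, smul_add, smul_smul, pow_two]

end

lemma abs_apply_le_norm {l : ℕ} (v : Eu l) (i : Fin l) : |v i| ≤ ‖v‖ :=
  PiLp.norm_apply_le v i

lemma exists_neck {l : ℕ} {u : E2 → Eu l} {ε a b : ℝ} (hε : 0 < ε) (ha : 0 < a) (hab : 2 * a ≤ b)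
    (hb : b < 1 / 2) (hu : ContDiffOn ℝ (⊤ : ℕ∞) u (ball 0 1))
    (hsph : ∀ x ∈ ball (0 : E2) 1, ‖u x‖ = 1) (hharm : IsEpsHarmonic ε (ball 0 1) u)
    (hder : ∀ t ∈ ({1, 2, 3} : Set ℕ), ∀ x : E2, a ≤ ‖x‖ → ‖x‖ ≤ b →
      ‖iteratedFDeriv ℝ t u x‖ ≤ √(1 / 80) / ‖x‖ ^ t) :
    ∃ f : Fin l → Sm, Neck f ε a b ∧
      ∀ x ∈ ball (0 : E2) (1 / 2), ∑ i, (Sm.L (f i)).1 x ^ 2 = ‖lap u x‖ ^ 2 := by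
  obtain ⟨f, hf⟩ := exists_Sm_extension hu
  have hsub : ball (0 : E2) (1 / 2) ⊆ ball 0 1 := ball_subset_ball (by norm_num)
  have hU : IsOpen (ball (0 : E2) (1 / 2)) := isOpen_ball
  have hv := hu.mono hsub
  have hD := fun α i => Sm.D_eq_pd hU hv (hf i) α
  have hL := fun i => Sm.L_eq_lap hU hv (hf i)
  have hLL := fun i => Sm.L_eq_lap hU (contDiffOn_lap hU hv) (hL i)
  have hmem : ∀ x : E2, ‖x‖ ≤ b → x ∈ ball (0 : E2) (1 / 2) := fun x hx => by
    rw [mem_ball_zero_iff]; exact hx.trans_lt hb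
  have h80 : √(1 / 80) ≤ 1 := Real.sqrt_le_one.2 (by norm_num)
  have hpow : ∀ (t : ℕ) (x : E2), √(1 / 80) / ‖x‖ ^ t ≤ 1 * ‖x‖ ^ (-(t : ℤ)) := by
    intro t x
    rw [zpow_neg, zpow_natCast, ← div_eq_mul_inv]
    gcongr
  refine ⟨f, ⟨hε, ha, hab, hb, ?_, ?_, ?_, ?_⟩, ?_⟩
  · intro x hx
    have h := hsph x (hsub hx)
    rw [Finset.sum_congr rfl fun i _ => by rw [hf i x hx], ← EuclideanSpace.real_norm_sq_eq, h,
      one_pow]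
  · intro x hx
    obtain ⟨c, hc⟩ := hharm x (hsub hx)
    refine ⟨c, fun i => ?_⟩
    have h := congrArg (fun w : Eu l => w i) hc
    simp only [PiLp.sub_apply, PiLp.smul_apply, smul_eq_mul] at h
    rw [hf i x hx, ← h, ← hL i x hx, ← hLL i x hx, sub_eq_add_neg, Sm.val_add, Sm.val_neg,
      Sm.val_smul, sub_eq_add_neg]
  · intro x hax hxb i
    have hx := hmem x hxb
    refine ⟨norm_pos_iff.1 (ha.trans_le hax), fun α => ?_, fun α β => ?_, fun α β γ => ?_⟩
    · rw [HB, hD α i x hx]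
      exact ((abs_apply_le_norm _ i).trans (norm_pd_le hU hv α hx)).trans
        ((hder 1 (by simp) x hax hxb).trans (hpow 1 x))
    · rw [HB, Sm.D_eq_pd hU (contDiffOn_pd hU hv β) (hD β i) α x hx]
      exact ((abs_apply_le_norm _ i).trans (norm_pd_pd_le hU hv α β hx)).trans
        ((hder 2 (by simp) x hax hxb).trans (hpow 2 x))
    · rw [HB, Sm.D_eq_pd hU (contDiffOn_pd hU (contDiffOn_pd hU hv γ) β)
        (Sm.D_eq_pd hU (contDiffOn_pd hU hv γ) (hD γ i) β) α x hx]
      exact ((abs_apply_le_norm _ i).trans (norm_pd_pd_pd_le hU hv α β γ hx)).trans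
        ((hder 3 (by simp) x hax hxb).trans (hpow 3 x))
  · intro x hax hxb
    have hx := hmem x hxb
    have hx0 : 0 < ‖x‖ := ha.trans_le hax
    have hpd : ∀ α, ‖pd α u x‖ ^ 2 * ‖x‖ ^ 2 ≤ 1 / 80 := by
      intro α
      have h := (norm_pd_le hU hv α hx).trans (hder 1 (by simp) x hax hxb)
      rw [pow_one, le_div_iff₀ hx0] at h
      have h2 := pow_le_pow_left₀ (by positivity) h 2
      rwa [Real.sq_sqrt (by norm_num), mul_pow] at h2
    have hsum : ∑ i, ((Sm.D 0 (f i)).1 x ^ 2 + (Sm.D 1 (f i)).1 x ^ 2)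
        = ‖pd 0 u x‖ ^ 2 + ‖pd 1 u x‖ ^ 2 := by
      rw [EuclideanSpace.real_norm_sq_eq, EuclideanSpace.real_norm_sq_eq, ← Finset.sum_add_distrib]
      exact Finset.sum_congr rfl fun i _ => by rw [hD 0 i x hx, hD 1 i x hx]
    rw [hsum]
    linarith [hpd 0, hpd 1]
  · intro x hx
    rw [EuclideanSpace.real_norm_sq_eq]
    exact Finset.sum_congr rfl fun i _ => by rw [hL i x hx]

/-- Near a point where the limit of the rescaled maps has nonzero Laplacian, the Laplacians of the
original maps are of order `r⁻²`. -/
lemma exists_lap_lower_bound {l : ℕ} {u : ℕ → E2 → Eu l}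
    (hu : ∀ k, ContDiffOn ℝ (⊤ : ℕ∞) (u k) (ball 0 1))
    {r : ℕ → ℝ} (hrpos : ∀ k, 0 < r k) (hr0 : Tendsto r atTop (nhds 0))
    {ω : E2 → Eu l} (hω : ContDiff ℝ (⊤ : ℕ∞) ω) {y₀ : E2} (hy₀ : lap ω y₀ ≠ 0)
    (hconv : ∀ K : Set E2, IsCompact K →
      TendstoUniformlyOn (fun k y => iteratedFDeriv ℝ 2 (fun z => u k (r k • z)) y)
        (iteratedFDeriv ℝ 2 ω) atTop K) :
    ∃ s > 0, ∃ m > 0, ∀ᶠ k in atTop, ∀ x ∈ ball (r k • y₀) (r k * s),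
      m / r k ^ 2 ≤ ‖lap (u k) x‖ := by
  have hm : 0 < ‖lap ω y₀‖ := norm_pos_iff.2 hy₀
  have hcont : Continuous fun y => ‖lap ω y‖ :=
    (contDiffOn_univ.1 (contDiffOn_lap isOpen_univ hω.contDiffOn)).continuous.norm
  have hev : ∀ᶠ y in nhds y₀, ‖lap ω y₀‖ / 2 < ‖lap ω y‖ :=
    hcont.continuousAt.eventually (lt_mem_nhds (half_lt_self hm))
  obtain ⟨s, hs, hball⟩ := Metric.eventually_nhds_iff_ball.1 hev
  refine ⟨s, hs, ‖lap ω y₀‖ / 4, by positivity, ?_⟩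
  have hunif := Metric.tendstoUniformlyOn_iff.1 (hconv _ (isCompact_closedBall y₀ s))
    (‖lap ω y₀‖ / 8) (by positivity)
  have hsmall : ∀ᶠ k in atTop, r k * (‖y₀‖ + s) < 1 := by
    have h := hr0.mul_const (‖y₀‖ + s)
    rw [zero_mul] at h
    exact h.eventually (gt_mem_nhds one_pos)
  filter_upwards [hunif, hsmall] with k hk hk1 x hx
  have hr := hrpos k
  obtain ⟨y, rfl⟩ : ∃ y, r k • y = x := ⟨(r k)⁻¹ • x, smul_inv_smul₀ hr.ne' x⟩
  have hy : y ∈ ball y₀ s := by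
    rw [mem_ball, dist_smul₀, Real.norm_of_nonneg hr.le] at hx
    exact lt_of_mul_lt_mul_left hx hr.le
  have hUo : IsOpen {z : E2 | r k • z ∈ ball (0 : E2) 1} :=
    isOpen_ball.preimage (continuous_const_smul (r k))
  have hyU : y ∈ {z : E2 | r k • z ∈ ball (0 : E2) 1} := by
    have h1 : ‖y‖ ≤ ‖y₀‖ + s := by
      have := norm_le_norm_add_norm_sub' y y₀
      rw [mem_ball, dist_eq_norm] at hy
      linarith
    change r k • y ∈ ball (0 : E2) 1
    rw [mem_ball_zero_iff, norm_smul, Real.norm_of_nonneg hr.le]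
    exact (mul_le_mul_of_nonneg_left h1 hr.le).trans_lt hk1
  have hvs : ContDiffOn ℝ (⊤ : ℕ∞) (fun z => u k (r k • z))
      {z : E2 | r k • z ∈ ball (0 : E2) 1} :=
    (hu k).comp (contDiff_const_smul (r k)).contDiffOn fun z hz => hz
  have hdiff := norm_lap_sub_le hUo hω.contDiffOn hvs hyU
  have hk2 := hk y (ball_subset_closedBall hy)
  rw [dist_eq_norm] at hk2
  rw [lap_comp_smul] at hdiff
  have hlow := hball y hy
  have htri := norm_sub_norm_le (lap ω y) (r k ^ 2 • lap (u k) (r k • y))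
  rw [norm_smul, Real.norm_of_nonneg (sq_nonneg _)] at htri
  rw [div_le_iff₀ (by positivity)]
  linarith

/-- a priori bound `limsup (ε_k/r_k²) log(1/r_k) < ∞` for a single-bubble
sequence of sphere-valued `ε_k`-harmonic maps with bounded `ε`-energy whose rescalings
`u_k(r_k ·)` converge in `C³` on compact sets to a nonconstant smooth bubble `ω` with
`0 < ∫_{ℝ²} |Δω|² < ∞`, under the single-bubble neck condition. -/
theorem eps_log_apriori_bound {l : ℕ} (hl : 2 ≤ l)
    (ε : ℕ → ℝ) (hεpos : ∀ k, 0 < ε k) (hε0 : Filter.Tendsto ε Filter.atTop (nhds 0))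
    (u : ℕ → E2 → Eu l)
    (hsm : ∀ k, ContDiffOn ℝ (⊤ : ℕ∞) (u k) (Metric.ball 0 1))
    (hsph : ∀ k, ∀ x ∈ Metric.ball (0 : E2) 1, ‖u k x‖ = 1)
    (hharm : ∀ k, IsEpsHarmonic (ε k) (Metric.ball 0 1) (u k))
    (hbd : ∃ Λ : ℝ, ∀ k, (∫ x in Metric.ball (0 : E2) 1, eDen (ε k) (u k) x) ≤ Λ)
    (r : ℕ → ℝ) (hrpos : ∀ k, 0 < r k) (hr0 : Filter.Tendsto r Filter.atTop (nhds 0))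
    (ω : E2 → Eu l) (hω : ContDiff ℝ (⊤ : ℕ∞) ω) (hωnc : ∃ x y : E2, ω x ≠ ω y)
    (hωE : 0 < ∫ x : E2, ‖lap ω x‖ ^ 2)
    (hωI : MeasureTheory.Integrable (fun x : E2 => ‖lap ω x‖ ^ 2))
    (hconv : ∀ K : Set E2, IsCompact K → ∀ t : ℕ, t ≤ 3 →
      TendstoUniformlyOn (fun k y => iteratedFDeriv ℝ t (fun z => u k ((r k) • z)) y)
        (iteratedFDeriv ℝ t ω) Filter.atTop K)
    (hneck : ∀ δ : ℝ, 0 < δ → ∃ R : ℝ, 1 ≤ R ∧ ∃ R₀ : ℝ, R₀ ∈ Set.Ioo (0 : ℝ) 1 ∧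
      ∃ K : ℕ, ∀ k ≥ K,
        (∀ t ∈ ({1, 2, 3} : Set ℕ), ∀ x : E2, 2 * R * r k ≤ ‖x‖ → ‖x‖ ≤ R₀ / 4 →
          ‖iteratedFDeriv ℝ t (u k) x‖ ≤ Real.sqrt δ / ‖x‖ ^ t) ∧
        (∀ a : ℝ, R * r k < a → a < R₀ / 2 →
          (∫ x in ann a (2 * a), eDen (ε k) (u k) x) ≤ δ)) :
    Filter.IsBoundedUnder (· ≤ ·) Filter.atTop
      (fun k => (ε k / (r k) ^ 2) * Real.log (1 / r k)) := by
  have hy₀ : ∃ y₀, lap ω y₀ ≠ 0 := by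
    by_contra! h
    simp [h] at hωE
  obtain ⟨y₀, hy₀⟩ := hy₀
  obtain ⟨s, hs, m, hm, hlow⟩ :=
    exists_lap_lower_bound hsm hrpos hr0 hω hy₀ fun K hK => hconv K hK 2 (by norm_num)
  obtain ⟨R, hR, R₀, ⟨hR₀, hR₀'⟩, K, hK⟩ := hneck (1 / 80) (by norm_num)
  obtain ⟨C, hC, hbound⟩ := exists_log_bound (Fin l)
  set P := max (2 * R) (‖y₀‖ + s) with hP
  have hP0 : 0 < P := lt_max_of_lt_left (by linarith)
  set c := m ^ 2 * (s ^ 2 * Real.pi) with hc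
  have hc0 : 0 < c := by positivity
  set κ := (R₀ / 4) ^ 2 / (4 * P ^ 2) with hκ
  have hκ0 : 0 < κ := by positivity
  have hsmall : ∀ᶠ k in atTop, 2 * (P * r k) ≤ R₀ / 4 := by
    have h := (hr0.const_mul P).const_mul 2
    rw [mul_zero, mul_zero] at h
    exact h.eventually_le_const (by positivity)
  have hlog : Tendsto (fun k => Real.log (1 / r k)) atTop atTop := by
    have h : Tendsto r atTop (nhdsWithin 0 (Set.Ioi 0)) :=
      tendsto_nhdsWithin_iff.2 ⟨hr0, Eventually.of_forall hrpos⟩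
    simp only [one_div]
    exact Real.tendsto_log_atTop.comp h.inv_tendsto_nhdsGT_zero
  refine isBoundedUnder_of_eventually_le (a := C / c) ?_
  filter_upwards [hlow, hsmall, eventually_ge_atTop K,
    hlog.eventually_ge_atTop (C / P ^ 2 / c - Real.log κ)] with k hlowk hsmallk hkK hlogk
  have hr := hrpos k
  have hε := hεpos k
  obtain ⟨f, hf, hfL⟩ := exists_neck hε (mul_pos hP0 hr) hsmallk (by linarith) (hsm k) (hsph k)
    (hharm k) fun t ht x hax hxb => (hK k hkK).1 t ht x
      ((mul_le_mul_of_nonneg_right (le_max_left _ _) hr.le).trans hax) hxb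
  have hsub : ball (r k • y₀) (r k * s) ⊆ closedBall 0 (P * r k) := by
    intro x hx
    rw [mem_closedBall_zero_iff]
    rw [mem_ball, dist_eq_norm] at hx
    have h1 := norm_le_norm_add_norm_sub' x (r k • y₀)
    rw [norm_smul, Real.norm_of_nonneg hr.le] at h1
    have h2 := mul_le_mul_of_nonneg_right (le_max_right (2 * R) (‖y₀‖ + s)) hr.le
    rw [← hP] at h2
    linarith
  have hmain := hbound f (ε k) (P * r k) (R₀ / 4) hf (r k • y₀) (r k * s) ((m / r k ^ 2) ^ 2)
    (by positivity) (by positivity) hsub fun x hx => by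
      rw [hfL x (by
        have := mem_closedBall_zero_iff.1 (hsub hx)
        rw [mem_ball_zero_iff]
        linarith [mul_pos hP0 hr])]
      exact pow_le_pow_left₀ (by positivity) (hlowk x hx) 2
  have hlogeq : Real.log ((R₀ / 4) ^ 2 / (4 * (P * r k) ^ 2))
      = Real.log κ + 2 * Real.log (1 / r k) := by
    rw [← Real.log_rpow (by positivity), ← Real.log_mul hκ0.ne' (by positivity), hκ]
    congr 1
    rw [Real.rpow_two]
    field_simp
  rw [hlogeq] at hmain
  set T := Real.log (1 / r k) with hT
  set Q := ε k / r k ^ 2 with hQ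
  have hQ0 : 0 < Q := by positivity
  have hl1 : ε k * ((Real.log κ + 2 * T) * (m / r k ^ 2) ^ 2 * ((r k * s) ^ 2 * Real.pi))
      = Q * ((Real.log κ + 2 * T) * c) := by
    rw [hQ, hc]
    field_simp
  have hl2 : C * (1 + ε k / (P * r k) ^ 2) = C + Q * (C / P ^ 2) := by
    rw [hQ]
    field_simp
  rw [hl1, hl2] at hmain
  have h3 : C / P ^ 2 + c * T ≤ (Real.log κ + 2 * T) * c := by
    have h := mul_le_mul_of_nonneg_right hlogk hc0.le
    rw [sub_mul, div_mul_cancel₀ _ hc0.ne'] at h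
    linarith
  rw [le_div_iff₀ hc0]
  have h4 := mul_le_mul_of_nonneg_left h3 hQ0.le
  linarith

end
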